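/- arXiv:1811.02975 — 2 statements merged into one kernel-verified Lean document; each statement's English description precedes it below -/
import Mathlib

section
/- Let Γ be a simplicial graph, let 𝒢 = {G_v : v ∈ V(Γ)} be a collection of non-trivial groups, and let X be the Cayley graph of the graph product Γ𝒢 with respect to the union of the non-identity elements of the vertex groups. Then the contact graph CX is a quasi-tree, and if Γ has bounded degree (there exists D ∈ ℕ such that each vertex of Γ has degree at most D), then the induced action of Γ𝒢 on CX is acylindrical. -/
namespace QM

variable {V : Type*}

/-- `y₁` and `y₂` lie (in this order) on a common geodesic from `x₁` to `x₂`. -/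
def OnGeod (X : SimpleGraph V) (x₁ y₁ y₂ x₂ : V) : Prop :=
  X.dist x₁ y₁ + X.dist y₁ y₂ + X.dist y₂ x₂ = X.dist x₁ x₂

/-- `(y₁, y₂, y₃)` is a `k`-quasi-median triple for `(x₁, x₂, x₃)` (without minimality). -/
def IsQMTriple (X : SimpleGraph V) (x₁ x₂ x₃ y₁ y₂ y₃ : V) (k : ℕ) : Prop :=
  OnGeod X x₁ y₁ y₂ x₂ ∧ OnGeod X x₁ y₁ y₃ x₃ ∧ OnGeod X x₂ y₂ y₃ x₃ ∧
    X.dist y₁ y₂ = k ∧ X.dist y₁ y₃ = k ∧ X.dist y₂ y₃ = k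

/-- `y` is a quasi-median of the triple `(x₁, x₂, x₃)`: it is a `k`-quasi-median triple
with `k` as small as possible. -/
def IsQuasiMedianTriple (X : SimpleGraph V) (x₁ x₂ x₃ : V) (y : V × V × V) : Prop :=
  ∃ k : ℕ, IsQMTriple X x₁ x₂ x₃ y.1 y.2.1 y.2.2 k ∧
    ∀ (k' : ℕ) (z₁ z₂ z₃ : V), IsQMTriple X x₁ x₂ x₃ z₁ z₂ z₃ k' → k ≤ k'

/-- The complete multipartite graph `K_{1,1,2}`: the complete graph on four vertices
with the edge between vertices `2` and `3` removed. -/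
def K112 : SimpleGraph (Fin 4) :=
  SimpleGraph.fromRel (fun i j => ¬(i = 2 ∧ j = 3) ∧ ¬(i = 3 ∧ j = 2))

/-- The 1-skeleton of the 3-cube. -/
def cubeGraph : SimpleGraph (Fin 3 → Bool) :=
  SimpleGraph.fromRel (fun x y => ∃! i, x i ≠ y i)

/-- The 6-cycle. -/
def C6 : SimpleGraph (Fin 6) := SimpleGraph.fromRel (fun i j => j = i + 1)

/-- A set of vertices is convex if it contains every vertex lying on a geodesic between
two of its members. -/
def IsConvexSet (X : SimpleGraph V) (S : Set V) : Prop :=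
  ∀ x ∈ S, ∀ y ∈ S, ∀ z : V, X.dist x z + X.dist z y = X.dist x y → z ∈ S

/-- The convex hull of a set of vertices. -/
def convexHullSet (X : SimpleGraph V) (S : Set V) : Set V :=
  ⋂₀ {T : Set V | S ⊆ T ∧ IsConvexSet X T}

/-- A quasi-median graph: a connected graph in which every triple of vertices has a unique
quasi-median, with no induced `K_{1,1,2}`, and in which the convex hull of every isometrically
embedded 6-cycle is isomorphic to the 3-cube. -/
structure IsQuasiMedian (X : SimpleGraph V) : Prop where
  connected : X.Connected
  uniqueQuasiMedian : ∀ x₁ x₂ x₃ : V, ∃! y : V × V × V, IsQuasiMedianTriple X x₁ x₂ x₃ y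
  noK112 : IsEmpty (SimpleGraph.Embedding K112 X)
  hullOfC6IsCube : ∀ f : Fin 6 → V,
    (∀ i j, C6.Adj i j → X.Adj (f i) (f j)) →
    (∀ i j, X.dist (f i) (f j) = C6.dist i j) →
    Nonempty (SimpleGraph.Iso
      (SimpleGraph.induce (convexHullSet X (Set.range f)) X) cubeGraph)

/-- Two edges are two sides of a common triangle, or opposite sides of a common square. -/
def SideRel (X : SimpleGraph V) (e f : Sym2 V) : Prop :=
  (∃ a b c : V, X.Adj a b ∧ X.Adj a c ∧ X.Adj b c ∧ e = s(a, b) ∧ f = s(a, c)) ∨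
  (∃ a b c d : V, X.Adj a b ∧ X.Adj c d ∧ X.Adj a c ∧ X.Adj b d ∧ a ≠ d ∧ b ≠ c ∧
    e = s(a, b) ∧ f = s(c, d))

/-- The equivalence class of an edge under the equivalence relation generated by `SideRel`. -/
def hypClass (X : SimpleGraph V) (e : Sym2 V) : Set (Sym2 V) :=
  {f | Relation.EqvGen (SideRel X) e f}

/-- A hyperplane: the equivalence class of some edge of `X`. -/
def IsHyperplane (X : SimpleGraph V) (H : Set (Sym2 V)) : Prop :=
  ∃ e ∈ X.edgeSet, H = hypClass X e

/-- The type of hyperplanes of `X`. -/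
def Hyperplane (X : SimpleGraph V) := {H : Set (Sym2 V) // IsHyperplane X H}

/-- Edges `e`, `e'` sharing the endpoint `p`, not lying in a common clique, that are
adjacent sides of a square of `X`: their dual hyperplanes intersect at `p`. -/
def IntersectAt (X : SimpleGraph V) (e e' : Sym2 V) (p : V) : Prop :=
  ∃ a b : V, e = s(p, a) ∧ e' = s(p, b) ∧ X.Adj p a ∧ X.Adj p b ∧ a ≠ b ∧ ¬ X.Adj a b ∧
    ∃ q : V, q ≠ p ∧ X.Adj a q ∧ X.Adj b q

/-- Edges `e`, `e'` sharing the endpoint `p`, not lying in a common clique, and not adjacent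
sides of any square of `X`: their dual hyperplanes osculate at `p`. -/
def OsculateAt (X : SimpleGraph V) (e e' : Sym2 V) (p : V) : Prop :=
  ∃ a b : V, e = s(p, a) ∧ e' = s(p, b) ∧ X.Adj p a ∧ X.Adj p b ∧ a ≠ b ∧ ¬ X.Adj a b ∧
    ¬ ∃ q : V, q ≠ p ∧ X.Adj a q ∧ X.Adj b q

/-- Hyperplanes `H` and `H'` intersect at `p`. -/
def HypIntersectAt (X : SimpleGraph V) (H H' : Hyperplane X) (p : V) : Prop :=
  ∃ e ∈ H.1, ∃ e' ∈ H'.1, IntersectAt X e e' p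

/-- Hyperplanes `H` and `H'` osculate at `p`. -/
def HypOsculateAt (X : SimpleGraph V) (H H' : Hyperplane X) (p : V) : Prop :=
  ∃ e ∈ H.1, ∃ e' ∈ H'.1, OsculateAt X e e' p

/-- Hyperplanes `H` and `H'` intersect. -/
def HypIntersect (X : SimpleGraph V) (H H' : Hyperplane X) : Prop :=
  ∃ p : V, HypIntersectAt X H H' p

/-- Hyperplanes `H` and `H'` osculate. -/
def HypOsculate (X : SimpleGraph V) (H H' : Hyperplane X) : Prop :=
  ∃ p : V, HypOsculateAt X H H' p

/-- The contact graph `𝒞X`: hyperplanes are adjacent iff they intersect or osculate. -/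
def contactGraph (X : SimpleGraph V) : SimpleGraph (Hyperplane X) :=
  SimpleGraph.fromRel (fun H H' => HypIntersect X H H' ∨ HypOsculate X H H')

/-- The crossing graph `ΔX`: hyperplanes are adjacent iff they intersect. -/
def crossingGraph (X : SimpleGraph V) : SimpleGraph (Hyperplane X) :=
  SimpleGraph.fromRel (fun H H' => HypIntersect X H H')

/-- The (vertex set of the) carrier of a hyperplane: all endpoints of its edges. -/
def hypCarrier (X : SimpleGraph V) (H : Hyperplane X) : Set V :=
  {v : V | ∃ e ∈ H.1, v ∈ e}

/-- A set of edges `H` (e.g. a hyperplane) separates `p` from `q` if every walk from `p`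
to `q` uses an edge of `H`. -/
def Separates (X : SimpleGraph V) (H : Set (Sym2 V)) (p q : V) : Prop :=
  ∀ w : X.Walk p q, ∃ e ∈ w.edges, e ∈ H

/-- `f` is a `(λ, c)`-quasi-isometry from `(A, dA)` to `(B, dB)`. -/
def IsQuasiIsometry {A B : Type*} (lam c : ℝ) (dA : A → A → ℝ) (dB : B → B → ℝ)
    (f : A → B) : Prop :=
  (∀ x y : A, dA x y / lam - c ≤ dB (f x) (f y) ∧ dB (f x) (f y) ≤ lam * dA x y + c) ∧
    ∀ b : B, ∃ a : A, dB (f a) b ≤ c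

end QM

namespace QM

variable {ι : Type*}

/-- The defining relators of the graph product: the multiplication tables of the vertex
groups and the commutators between adjacent vertex groups. -/
def gpRels (Γ : SimpleGraph ι) (Gv : ι → Type*) [∀ v, Group (Gv v)] :
    Set (FreeGroup (Σ v : ι, Gv v)) :=
  {r | (∃ (v : ι) (g h : Gv v),
          r = FreeGroup.of (⟨v, g⟩ : Σ v, Gv v) * FreeGroup.of (⟨v, h⟩ : Σ v, Gv v) *
              (FreeGroup.of (⟨v, g * h⟩ : Σ v, Gv v))⁻¹) ∨
       (∃ (v w : ι) (g : Gv v) (h : Gv w), Γ.Adj v w ∧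
          r = FreeGroup.of (⟨v, g⟩ : Σ v, Gv v) * FreeGroup.of (⟨w, h⟩ : Σ v, Gv v) *
              (FreeGroup.of (⟨v, g⟩ : Σ v, Gv v))⁻¹ * (FreeGroup.of (⟨w, h⟩ : Σ v, Gv v))⁻¹)}

/-- The graph product of the groups `Gv v` over the simplicial graph `Γ`. -/
def GraphProduct (Γ : SimpleGraph ι) (Gv : ι → Type*) [∀ v, Group (Gv v)] :=
  PresentedGroup (gpRels Γ Gv)

instance (Γ : SimpleGraph ι) (Gv : ι → Type*) [∀ v, Group (Gv v)] :
    Group (GraphProduct Γ Gv) := by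
  unfold GraphProduct; infer_instance

/-- The canonical image of an element of a vertex group in the graph product. -/
def gpOf (Γ : SimpleGraph ι) (Gv : ι → Type*) [∀ v, Group (Gv v)] (v : ι) (g : Gv v) :
    GraphProduct Γ Gv :=
  PresentedGroup.of (⟨v, g⟩ : Σ v, Gv v)

/-- The Cayley graph of the graph product `Γ𝒢` with respect to the generating set consisting
of all non-identity elements of the vertex groups (with edges `(x, s·x)`). -/
def gpCayley (Γ : SimpleGraph ι) (Gv : ι → Type*) [∀ v, Group (Gv v)] :
    SimpleGraph (GraphProduct Γ Gv) :=
  SimpleGraph.fromRel (fun x y => ∃ (v : ι) (g : Gv v), g ≠ 1 ∧ y = gpOf Γ Gv v g * x)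

end QM

namespace QM

/-- A graph is a quasi-tree if some simplicial tree admits a quasi-isometry to it. -/
def IsQuasiTreeGraph {W : Type u} (Y : SimpleGraph W) : Prop :=
  ∃ (T : Type u) (Tr : SimpleGraph T), Tr.IsAcyclic ∧ Tr.Preconnected ∧
    ∃ (f : T → W) (lam c : ℝ), 0 < lam ∧ 0 ≤ c ∧
      IsQuasiIsometry lam c (fun a b => (Tr.dist a b : ℝ)) (fun a b => (Y.dist a b : ℝ)) f

/-- The translate of the hyperplane `A` of the Cayley graph of a graph product under the
right action of `g` is within contact-graph distance `ε` of `A`. -/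
def gpTranslateDistLE {ι : Type*} (Γ : SimpleGraph ι) (Gv : ι → Type*) [∀ v, Group (Gv v)]
    (g : GraphProduct Γ Gv) (A : Hyperplane (gpCayley Γ Gv)) (ε : ℝ) : Prop :=
  ∃ A' : Hyperplane (gpCayley Γ Gv),
    A'.1 = Sym2.map (fun x => x * g) '' A.1 ∧
    ((contactGraph (gpCayley Γ Gv)).dist A A' : ℝ) ≤ ε

section GroupTheory

variable {ι : Type*} {Γ : SimpleGraph ι} {Gv : ι → Type*} [∀ v, Group (Gv v)]

theorem gpOf_mul (v : ι) (g h : Gv v) :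
    gpOf Γ Gv v (g * h) = gpOf Γ Gv v g * gpOf Γ Gv v h := by
  have h1 := PresentedGroup.one_of_mem (rels := gpRels Γ Gv) (Or.inl ⟨v, g, h, rfl⟩)
  rw [map_mul, map_mul, map_inv, mul_inv_eq_one] at h1
  exact h1.symm

theorem gpOf_one (v : ι) : gpOf Γ Gv v 1 = 1 := by
  have h := gpOf_mul (Γ := Γ) v (1 : Gv v) 1
  rw [mul_one] at h
  exact mul_eq_left.mp h.symm

theorem gpOf_inv (v : ι) (g : Gv v) : gpOf Γ Gv v g⁻¹ = (gpOf Γ Gv v g)⁻¹ := by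
  rw [eq_inv_iff_mul_eq_one, ← gpOf_mul, inv_mul_cancel, gpOf_one]

theorem gpOf_comm {v w : ι} (h : Γ.Adj v w) (g : Gv v) (k : Gv w) :
    gpOf Γ Gv v g * gpOf Γ Gv w k = gpOf Γ Gv w k * gpOf Γ Gv v g := by
  have h1 := PresentedGroup.one_of_mem (rels := gpRels Γ Gv) (Or.inr ⟨v, w, g, k, h, rfl⟩)
  rw [map_mul, map_mul, map_mul, map_inv, map_inv, mul_inv_eq_one, mul_inv_eq_iff_eq_mul] at h1
  exact h1

/-- Induction on the number of syllables. -/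
theorem gp_induction {p : GraphProduct Γ Gv → Prop} (one : p 1)
    (mul : ∀ (v : ι) (s : Gv v) (g : GraphProduct Γ Gv), p g → p (gpOf Γ Gv v s * g))
    (g : GraphProduct Γ Gv) : p g := by
  have hg : g ∈ Subgroup.closure (Set.range (PresentedGroup.of (rels := gpRels Γ Gv))) := by
    rw [PresentedGroup.closure_range_of]; trivial
  induction hg using Subgroup.closure_induction_left with
  | one => exact one
  | mul_left x hx y _ ih =>
    obtain ⟨⟨v, s⟩, rfl⟩ := hx
    exact mul v s y ih
  | inv_mul_cancel x hx y _ ih =>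
    obtain ⟨⟨v, s⟩, rfl⟩ := hx
    have h := mul v s⁻¹ y ih
    rw [gpOf_inv] at h
    exact h

/-- The universal property of the graph product. -/
def gpLift {K : Type*} [Group K] (f : ∀ v, Gv v → K)
    (hmul : ∀ v g h, f v (g * h) = f v g * f v h)
    (hcomm : ∀ v w, Γ.Adj v w → ∀ g h, f v g * f w h = f w h * f v g) :
    GraphProduct Γ Gv →* K :=
  PresentedGroup.toGroup (rels := gpRels Γ Gv) (f := fun x => f x.1 x.2) (by
    rintro r (⟨v, g, h, rfl⟩ | ⟨v, w, g, h, hvw, rfl⟩)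
    · simp [hmul]
    · simp [hcomm v w hvw])

theorem gpLift_of {K : Type*} [Group K] (f : ∀ v, Gv v → K) (hmul) (hcomm) (v : ι) (g : Gv v) :
    gpLift (Γ := Γ) f hmul hcomm (gpOf Γ Gv v g) = f v g :=
  PresentedGroup.toGroup.of _

open Classical in
/-- The projection of the graph product onto the direct product of the vertex groups. -/
noncomputable def gpProj : GraphProduct Γ Gv →* ∀ v, Gv v :=
  gpLift (fun v g => Pi.mulSingle v g) (fun v g h => Pi.mulSingle_mul v g h)
    (fun _ _ hvw g h => Pi.mulSingle_commute hvw.ne g h)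

open Classical in
theorem gpProj_of_same (v : ι) (g : Gv v) : gpProj (gpOf Γ Gv v g) v = g :=
  (congrFun (gpLift_of _ _ _ v g) v).trans (Pi.mulSingle_eq_same v g)

open Classical in
theorem gpProj_of_ne {v w : ι} (h : w ≠ v) (g : Gv v) : gpProj (gpOf Γ Gv v g) w = 1 :=
  (congrFun (gpLift_of _ _ _ v g) w).trans (Pi.mulSingle_eq_of_ne h g)

theorem gpOf_eq_one {v : ι} {g : Gv v} (h : gpOf Γ Gv v g = 1) : g = 1 := by
  rw [← gpProj_of_same (Γ := Γ) v g, h, map_one, Pi.one_apply]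

/-- The subgroup generated by the vertex groups in the star of `v`. -/
def gpStar (Γ : SimpleGraph ι) (Gv : ι → Type*) [∀ v, Group (Gv v)] (v : ι) :
    Subgroup (GraphProduct Γ Gv) :=
  Subgroup.closure {x | ∃ (w : ι) (s : Gv w), (w = v ∨ Γ.Adj v w) ∧ x = gpOf Γ Gv w s}

theorem gpOf_mem_gpStar {v w : ι} (h : w = v ∨ Γ.Adj v w) (s : Gv w) :
    gpOf Γ Gv w s ∈ gpStar Γ Gv v :=
  Subgroup.subset_closure ⟨w, s, h, rfl⟩

@[elab_as_elim]
theorem gpStar_induction {v : ι} {p : ∀ g : GraphProduct Γ Gv, g ∈ gpStar Γ Gv v → Prop}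
    (one : p 1 (one_mem _))
    (mul : ∀ (w : ι) (s : Gv w) (g : GraphProduct Γ Gv) (hw : w = v ∨ Γ.Adj v w)
      (hg : g ∈ gpStar Γ Gv v), p g hg →
        p (gpOf Γ Gv w s * g) (mul_mem (Subgroup.subset_closure ⟨w, s, hw, rfl⟩) hg))
    {g : GraphProduct Γ Gv} (hg : g ∈ gpStar Γ Gv v) : p g hg := by
  induction hg using Subgroup.closure_induction_left with
  | one => exact one
  | mul_left x hx y hy ih =>
    obtain ⟨w, s, h, rfl⟩ := hx
    exact mul w s y h hy ih
  | inv_mul_cancel x hx y hy ih =>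
    obtain ⟨w, s, h, rfl⟩ := hx
    have h1 := mul w s⁻¹ y h hy ih
    simp only [gpOf_inv] at h1
    exact h1

theorem gpProj_gpStar {v w : ι} (h : ¬(w = v ∨ Γ.Adj v w)) {g : GraphProduct Γ Gv}
    (hg : g ∈ gpStar Γ Gv v) : gpProj g w = 1 := by
  induction hg using gpStar_induction with
  | one => simp
  | mul u s g hu _ ih =>
    have : w ≠ u := by rintro rfl; exact h hu
    rw [map_mul, Pi.mul_apply, ih, gpProj_of_ne this, mul_one]

theorem gpOf_mem_gpStar_iff {v w : ι} {s : Gv w} (hs : s ≠ 1) :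
    gpOf Γ Gv w s ∈ gpStar Γ Gv v ↔ w = v ∨ Γ.Adj v w := by
  refine ⟨fun h => ?_, fun h => gpOf_mem_gpStar h s⟩
  by_contra hn
  exact hs ((gpProj_of_same (Γ := Γ) w s).symm.trans (gpProj_gpStar hn h))

open Classical in
/-- The value, in the `v`-component, by which left multiplication by `x` changes the sector of
a vertex `g` with respect to the base hyperplane labelled `v`. -/
noncomputable def sectorFactor (v : ι) (x g : GraphProduct Γ Gv) : Gv v :=
  if g ∈ gpStar Γ Gv v then gpProj x v else 1

theorem sectorFactor_congr {v : ι} {g h : GraphProduct Γ Gv}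
    (H : g ∈ gpStar Γ Gv v ↔ h ∈ gpStar Γ Gv v) (x : GraphProduct Γ Gv) :
    sectorFactor v x g = sectorFactor v x h := by
  unfold sectorFactor
  by_cases hg : g ∈ gpStar Γ Gv v
  · rw [if_pos hg, if_pos (H.1 hg)]
  · rw [if_neg hg, if_neg (fun h => hg (H.2 h))]

theorem sectorFactor_mul (v : ι) (x y g : GraphProduct Γ Gv) :
    sectorFactor v (x * y) g = sectorFactor v x g * sectorFactor v y g := by
  unfold sectorFactor
  split_ifs
  · rw [map_mul, Pi.mul_apply]
  · rw [one_mul]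

theorem sectorFactor_of_ne {v w : ι} (h : v ≠ w) (s : Gv w) (g : GraphProduct Γ Gv) :
    sectorFactor v (gpOf Γ Gv w s) g = 1 := by
  unfold sectorFactor
  split_ifs
  · exact gpProj_of_ne h s
  · rfl

theorem sectorFactor_of_mul (v w u : ι) (h : w = u ∨ Γ.Adj u w) (s : Gv w)
    (t : Gv u) (g : GraphProduct Γ Gv) :
    sectorFactor v (gpOf Γ Gv w s) (gpOf Γ Gv u t * g) * sectorFactor v (gpOf Γ Gv u t) g =
      sectorFactor v (gpOf Γ Gv w s * gpOf Γ Gv u t) g := by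
  by_cases hw : w = v
  · subst hw
    have hu : u = w ∨ Γ.Adj w u := h.imp Eq.symm SimpleGraph.Adj.symm
    rw [sectorFactor_mul,
      sectorFactor_congr ((gpStar Γ Gv w).mul_mem_cancel_left (gpOf_mem_gpStar hu t))]
  · rw [sectorFactor_mul, sectorFactor_of_ne (Ne.symm hw), sectorFactor_of_ne (Ne.symm hw)]

/-- Left multiplication by a syllable, acting on vertices together with their sector. -/
noncomputable def sectorPerm (v w : ι) (s : Gv w) : Equiv.Perm (GraphProduct Γ Gv × Gv v) where
  toFun p := (gpOf Γ Gv w s * p.1, sectorFactor v (gpOf Γ Gv w s) p.1 * p.2)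
  invFun p := (gpOf Γ Gv w s⁻¹ * p.1, sectorFactor v (gpOf Γ Gv w s⁻¹) p.1 * p.2)
  left_inv p := by
    refine Prod.ext ?_ ?_
    · simp [gpOf_inv]
    · dsimp only
      rw [← mul_assoc, sectorFactor_of_mul v w w (Or.inl rfl), ← gpOf_mul]
      simp [sectorFactor, gpOf_one]
  right_inv p := by
    refine Prod.ext ?_ ?_
    · simp [gpOf_inv]
    · dsimp only
      rw [← mul_assoc, sectorFactor_of_mul v w w (Or.inl rfl), ← gpOf_mul]
      simp [sectorFactor, gpOf_one]

/-- The action of the graph product on vertices together with their sector. -/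
noncomputable def sectorAction (v : ι) :
    GraphProduct Γ Gv →* Equiv.Perm (GraphProduct Γ Gv × Gv v) :=
  gpLift (fun w s => sectorPerm v w s)
    (fun w s t => by
      ext p
      · simp [sectorPerm, gpOf_mul, mul_assoc]
      · simp only [sectorPerm, Equiv.coe_fn_mk, Equiv.Perm.mul_apply, gpOf_mul,
          ← sectorFactor_of_mul v w w (Or.inl rfl), mul_assoc])
    (fun w u hwu s t => by
      ext p
      · simp only [sectorPerm, Equiv.coe_fn_mk, Equiv.Perm.mul_apply]
        rw [← mul_assoc, ← mul_assoc, gpOf_comm hwu]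
      · simp only [sectorPerm, Equiv.coe_fn_mk, Equiv.Perm.mul_apply]
        rw [← mul_assoc, ← mul_assoc, sectorFactor_of_mul v w u (Or.inr hwu.symm),
          sectorFactor_of_mul v u w (Or.inr hwu), gpOf_comm hwu])

theorem sectorAction_of (v w : ι) (s : Gv w) :
    sectorAction v (gpOf Γ Gv w s) = sectorPerm v w s :=
  gpLift_of _ _ _ w s

theorem sectorAction_fst (v : ι) (g : GraphProduct Γ Gv) :
    (sectorAction v g (1, 1)).1 = g := by
  induction g using gp_induction with
  | one => simp
  | mul w s g ih =>
    rw [map_mul, Equiv.Perm.mul_apply, sectorAction_of]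
    exact congrArg (gpOf Γ Gv w s * ·) ih

/-- The sector of `g` with respect to the hyperplane labelled `v` at the identity. -/
noncomputable def sector (v : ι) (g : GraphProduct Γ Gv) : Gv v :=
  (sectorAction v g (1, 1)).2

theorem sector_one (v : ι) : sector v (1 : GraphProduct Γ Gv) = 1 := by
  simp [sector]

theorem sector_of_mul (v w : ι) (s : Gv w) (g : GraphProduct Γ Gv) :
    sector v (gpOf Γ Gv w s * g) = sectorFactor v (gpOf Γ Gv w s) g * sector v g := by
  rw [sector, map_mul, Equiv.Perm.mul_apply, sectorAction_of]
  change sectorFactor v (gpOf Γ Gv w s) (sectorAction v g (1, 1)).1 * _ = _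
  rw [sectorAction_fst, sector]

theorem sector_of_mul_of_mem {v : ι} (s : Gv v) {g : GraphProduct Γ Gv}
    (hg : g ∈ gpStar Γ Gv v) : sector v (gpOf Γ Gv v s * g) = s * sector v g := by
  rw [sector_of_mul, sectorFactor, if_pos hg, gpProj_of_same]

theorem sector_of_mul_of_not {v w : ι} (s : Gv w) {g : GraphProduct Γ Gv}
    (h : ¬(w = v ∧ g ∈ gpStar Γ Gv v)) : sector v (gpOf Γ Gv w s * g) = sector v g := by
  rw [sector_of_mul, sectorFactor]
  split_ifs with hg
  · rw [gpProj_of_ne (fun e => h ⟨e.symm, hg⟩), one_mul]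
  · rw [one_mul]

theorem sector_mul_of_mem {v : ι} (g : GraphProduct Γ Gv) {k : GraphProduct Γ Gv}
    (hk : k ∈ gpStar Γ Gv v) : sector v (g * k) = sector v g * sector v k := by
  induction g using gp_induction with
  | one => simp [sector_one]
  | mul w s g ih =>
    rw [mul_assoc, sector_of_mul, sector_of_mul, ih, mul_assoc]
    rw [sectorFactor_congr ((gpStar Γ Gv v).mul_mem_cancel_right hk)]

/-- Elements of the star of `v` split into a `v`-syllable and an element commuting with the
vertex group of `v`. -/
theorem gpStar_split {v : ι} {k : GraphProduct Γ Gv} (hk : k ∈ gpStar Γ Gv v) :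
    ∃ c, k = gpOf Γ Gv v (sector v k) * c ∧
      ∀ t : Gv v, gpOf Γ Gv v t * c = c * gpOf Γ Gv v t := by
  induction hk using gpStar_induction with
  | one => exact ⟨1, by simp [sector_one, gpOf_one], by simp⟩
  | mul w s g hw hg ih =>
    obtain ⟨c, hc, hcomm⟩ := ih
    rcases hw with rfl | hw
    · refine ⟨c, ?_, hcomm⟩
      rw [sector_of_mul_of_mem s hg, gpOf_mul, mul_assoc, ← hc]
    · refine ⟨gpOf Γ Gv w s * c, ?_, fun t => ?_⟩
      · rw [sector_of_mul_of_not s (fun h => hw.ne h.1.symm), ← mul_assoc, gpOf_comm hw, mul_assoc,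
          ← hc]
      · rw [← mul_assoc, gpOf_comm hw, mul_assoc, hcomm, mul_assoc]

theorem gpOf_comm_of_sector_eq_one {v : ι} {k : GraphProduct Γ Gv} (hk : k ∈ gpStar Γ Gv v)
    (h1 : sector v k = 1) (t : Gv v) : gpOf Γ Gv v t * k = k * gpOf Γ Gv v t := by
  obtain ⟨c, hc, hcomm⟩ := gpStar_split hk
  rw [h1, gpOf_one, one_mul] at hc
  rw [hc, hcomm]

/-- Non-trivial syllables over distinct non-adjacent vertices do not commute. -/
theorem adj_of_gpOf_comm {v w : ι} (hvw : v ≠ w) {s : Gv v} {t : Gv w} (hs : s ≠ 1) (ht : t ≠ 1)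
    (h : gpOf Γ Gv v s * gpOf Γ Gv w t = gpOf Γ Gv w t * gpOf Γ Gv v s) : Γ.Adj v w := by
  by_contra hn
  have hmem : gpOf Γ Gv w t ∉ gpStar Γ Gv v := by
    rw [gpOf_mem_gpStar_iff ht]; tauto
  have h1 : sector v (gpOf Γ Gv v s * gpOf Γ Gv w t) = 1 := by
    rw [sector_of_mul_of_not _ (fun h => hmem h.2)]
    rw [← mul_one (gpOf Γ Gv w t), sector_of_mul_of_not _ (fun h => hvw h.1.symm), sector_one]
  have h2 : sector v (gpOf Γ Gv w t * gpOf Γ Gv v s) = s := by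
    rw [sector_of_mul_of_not _ (fun h => hvw h.1.symm), ← mul_one (gpOf Γ Gv v s),
      sector_of_mul_of_mem _ (one_mem _), sector_one, mul_one]
  exact hs (by rw [← h2, ← h, h1])

end GroupTheory

section Hyperplanes

variable {ι : Type*} {Γ : SimpleGraph ι} {Gv : ι → Type*} [∀ v, Group (Gv v)]

theorem gpCayley_adj {a b : GraphProduct Γ Gv} :
    (gpCayley Γ Gv).Adj a b ↔ ∃ (v : ι) (s : Gv v), s ≠ 1 ∧ b = gpOf Γ Gv v s * a := by
  rw [gpCayley, SimpleGraph.fromRel_adj]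
  constructor
  · rintro ⟨-, h | ⟨v, s, hs, rfl⟩⟩
    · exact h
    · exact ⟨v, s⁻¹, inv_ne_one.2 hs, by rw [gpOf_inv, inv_mul_cancel_left]⟩
  · rintro ⟨v, s, hs, rfl⟩
    exact ⟨fun h => hs (gpOf_eq_one (Γ := Γ) (mul_eq_right.mp h.symm)), Or.inl ⟨v, s, hs, rfl⟩⟩

theorem eq_of_gpProj_of_ne_one {v w : ι} {s : Gv w} (h : gpProj (gpOf Γ Gv w s) v ≠ 1) : w = v := by
  by_contra hn
  exact h (gpProj_of_ne (Ne.symm hn) s)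

theorem eq_of_gpOf_eq {v w : ι} {s : Gv v} {t : Gv w} (hs : s ≠ 1)
    (h : gpOf Γ Gv v s = gpOf Γ Gv w t) : w = v := by
  apply eq_of_gpProj_of_ne_one (Γ := Γ) (s := t)
  rwa [← h, gpProj_of_same]

theorem eq_of_gpOf_eq_mul {v w u : ι} {s : Gv v} {t : Gv w} {r : Gv u} (hs : s ≠ 1) (ht : t ≠ 1)
    (h : gpOf Γ Gv w t = gpOf Γ Gv u r * gpOf Γ Gv v s) : w = v := by
  by_contra hn
  have hw := congrFun (congrArg gpProj h) w
  have hv := congrFun (congrArg gpProj h) v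
  rw [map_mul, Pi.mul_apply, gpProj_of_same, gpProj_of_ne hn, mul_one] at hw
  have hu : u = w := eq_of_gpProj_of_ne_one (Γ := Γ) (s := r) (by rw [← hw]; exact ht)
  subst hu
  rw [map_mul, Pi.mul_apply, gpProj_of_same, gpProj_of_ne (Ne.symm hn), gpProj_of_ne (Ne.symm hn),
    one_mul] at hv
  exact hs hv.symm

/-- The edges dual to the hyperplane labelled `v` that passes through `x`. -/
def hypEdges (Γ : SimpleGraph ι) (Gv : ι → Type*) [∀ v, Group (Gv v)] (v : ι)
    (x : GraphProduct Γ Gv) : Set (Sym2 (GraphProduct Γ Gv)) :=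
  {e | ∃ (p : GraphProduct Γ Gv) (s : Gv v), s ≠ 1 ∧ p * x⁻¹ ∈ gpStar Γ Gv v ∧
    e = s(p, gpOf Γ Gv v s * p)}

theorem mem_hypEdges {v : ι} {x a b : GraphProduct Γ Gv} :
    s(a, b) ∈ hypEdges Γ Gv v x ↔
      a * x⁻¹ ∈ gpStar Γ Gv v ∧ ∃ s : Gv v, s ≠ 1 ∧ b = gpOf Γ Gv v s * a := by
  constructor
  · rintro ⟨p, s, hs, hp, he⟩
    rcases Sym2.eq_iff.1 he with ⟨rfl, rfl⟩ | ⟨rfl, rfl⟩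
    · exact ⟨hp, s, hs, rfl⟩
    · refine ⟨?_, s⁻¹, inv_ne_one.2 hs, by rw [gpOf_inv, inv_mul_cancel_left]⟩
      rw [mul_assoc]
      exact mul_mem (gpOf_mem_gpStar (Or.inl rfl) s) hp
  · rintro ⟨hp, s, hs, rfl⟩
    exact ⟨a, s, hs, hp, rfl⟩

theorem SideRel.symm' {V : Type*} {X : SimpleGraph V} {e f : Sym2 V} (h : SideRel X e f) :
    SideRel X f e := by
  rcases h with ⟨a, b, c, hab, hac, hbc, he, hf⟩ |
    ⟨a, b, c, d, hab, hcd, hac, hbd, had, hbc, he, hf⟩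
  · exact Or.inl ⟨a, c, b, hac, hab, hbc.symm, hf, he⟩
  · exact Or.inr ⟨c, d, a, b, hcd, hab, hac.symm, hbd.symm, hbc.symm, had.symm, hf, he⟩

theorem mem_hypEdges_of_sideRel {v : ι} {x : GraphProduct Γ Gv} {e f : Sym2 (GraphProduct Γ Gv)}
    (h : SideRel (gpCayley Γ Gv) e f) (he : e ∈ hypEdges Γ Gv v x) : f ∈ hypEdges Γ Gv v x := by
  rcases h with ⟨a, b, c, hab, hac, hbc, rfl, rfl⟩ |
    ⟨a, b, c, d, hab, hcd, hac, hbd, had, hbc, rfl, rfl⟩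
  · obtain ⟨ha, s, hs, rfl⟩ := mem_hypEdges.1 he
    obtain ⟨w, t, ht, rfl⟩ := gpCayley_adj.1 hac
    obtain ⟨u, r, hr, h⟩ := gpCayley_adj.1 hbc
    rw [← mul_assoc, mul_left_inj] at h
    obtain rfl := eq_of_gpOf_eq_mul hs ht h
    exact mem_hypEdges.2 ⟨ha, t, ht, rfl⟩
  · obtain ⟨ha, s, hs, rfl⟩ := mem_hypEdges.1 he
    obtain ⟨w, t, ht, rfl⟩ := gpCayley_adj.1 hac
    obtain ⟨u, r, hr, rfl⟩ := gpCayley_adj.1 hcd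
    obtain ⟨z, q, hq, h⟩ := gpCayley_adj.1 hbd
    rw [← mul_assoc, ← mul_assoc, mul_left_inj] at h
    by_cases huv : u = v
    · subst huv
      have hw : w = u ∨ Γ.Adj u w := by
        by_cases hwu : w = u
        · exact Or.inl hwu
        · refine Or.inr ?_
          have h1 := congrFun (congrArg gpProj h) w
          have h2 := congrFun (congrArg gpProj h) u
          rw [map_mul, map_mul, Pi.mul_apply, Pi.mul_apply, gpProj_of_same, gpProj_of_ne hwu,
            gpProj_of_ne hwu, mul_one, one_mul] at h1
          have hz : z = w := eq_of_gpProj_of_ne_one (Γ := Γ) (s := q) (by rw [← h1]; exact ht)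
          subst hz
          rw [map_mul, map_mul, Pi.mul_apply, Pi.mul_apply, gpProj_of_same, gpProj_of_same,
            gpProj_of_ne (Ne.symm hwu), gpProj_of_ne (Ne.symm hwu), mul_one, one_mul] at h2
          rw [gpProj_of_same] at h1
          subst h1 h2
          exact adj_of_gpOf_comm (Ne.symm hwu) hs ht h
      refine mem_hypEdges.2 ⟨?_, r, hr, rfl⟩
      rw [mul_assoc]
      exact mul_mem (gpOf_mem_gpStar hw t) ha
    · exfalso
      have h2 := congrFun (congrArg gpProj h) v
      by_cases hwv : w = v
      · subst hwv
        have h1 := congrFun (congrArg gpProj h) u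
        rw [map_mul, map_mul, Pi.mul_apply, Pi.mul_apply, gpProj_of_same, gpProj_of_ne huv,
            gpProj_of_ne huv, mul_one, mul_one] at h1
        have hz : z = u := eq_of_gpProj_of_ne_one (Γ := Γ) (s := q) (by rw [← h1]; exact hr)
        subst hz
        rw [gpProj_of_same] at h1
        subst h1
        exact hbc (by rw [mul_left_cancel h])
      · rw [map_mul, map_mul, Pi.mul_apply, Pi.mul_apply, gpProj_of_same,
          gpProj_of_ne (Ne.symm huv), gpProj_of_ne (Ne.symm hwv), mul_one] at h2
        have hz : z = v := eq_of_gpProj_of_ne_one (Γ := Γ) (s := q) (by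
          intro h0; rw [h0, one_mul] at h2; exact hs h2.symm)
        subst hz
        rw [gpProj_of_same] at h2
        apply had
        rw [← mul_assoc, h, ← gpOf_mul, ← h2, gpOf_one, one_mul]

theorem eqvGen_same_point {v : ι} (x : GraphProduct Γ Gv) {s t : Gv v} (hs : s ≠ 1) (ht : t ≠ 1) :
    Relation.EqvGen (SideRel (gpCayley Γ Gv)) s(x, gpOf Γ Gv v s * x) s(x, gpOf Γ Gv v t * x) := by
  by_cases h : s = t
  · rw [h]; exact .refl _
  · refine .rel _ _ (Or.inl ⟨x, _, _, gpCayley_adj.2 ⟨v, s, hs, rfl⟩,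
      gpCayley_adj.2 ⟨v, t, ht, rfl⟩,
      gpCayley_adj.2 ⟨v, t * s⁻¹, fun h' => h (mul_inv_eq_one.1 h').symm, ?_⟩, rfl, rfl⟩)
    rw [← mul_assoc, ← gpOf_mul, inv_mul_cancel_right]

theorem eqvGen_of_mem_gpStar {v : ι} (x : GraphProduct Γ Gv) {t : Gv v} (ht : t ≠ 1)
    {k : GraphProduct Γ Gv} (hk : k ∈ gpStar Γ Gv v) : ∀ s : Gv v, s ≠ 1 →
    Relation.EqvGen (SideRel (gpCayley Γ Gv)) s(x, gpOf Γ Gv v t * x)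
      s(k * x, gpOf Γ Gv v s * (k * x)) := by
  induction hk using gpStar_induction with
  | one => intro s hs; rw [one_mul]; exact eqvGen_same_point x ht hs
  | mul w r k hw hk ih =>
    intro s hs
    rw [mul_assoc]
    generalize k * x = y at ih
    by_cases hr : r = 1
    · rw [hr, gpOf_one, one_mul]; exact ih s hs
    by_cases hwv : w = v
    · subst hwv
      refine (ih r hr).trans _ _ _ ?_
      have := eqvGen_same_point (gpOf Γ Gv w r * y) (inv_ne_one.2 hr) hs
      rwa [gpOf_inv, inv_mul_cancel_left, Sym2.eq_swap] at this
    · have hvw := hw.resolve_left hwv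
      refine (ih s hs).trans _ _ _ (.rel _ _ (Or.inr ⟨y, _, _, _, gpCayley_adj.2 ⟨v, s, hs, rfl⟩,
        gpCayley_adj.2 ⟨v, s, hs, rfl⟩, gpCayley_adj.2 ⟨w, r, hr, rfl⟩,
        gpCayley_adj.2 ⟨w, r, hr, ?_⟩, ?_, ?_, rfl, rfl⟩))
      · rw [← mul_assoc, gpOf_comm hvw, mul_assoc]
      · intro h
        rw [← mul_assoc] at h
        have h := congrFun (congrArg gpProj (mul_eq_right.mp h.symm)) v
        rw [map_mul, Pi.mul_apply, gpProj_of_same, gpProj_of_ne (Ne.symm hwv), mul_one] at h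
        exact hs (by simpa using h)
      · intro h
        exact hwv (eq_of_gpOf_eq hs (mul_right_cancel h))

theorem hypClass_eq {v : ι} (x : GraphProduct Γ Gv) {t : Gv v} (ht : t ≠ 1) :
    hypClass (gpCayley Γ Gv) s(x, gpOf Γ Gv v t * x) = hypEdges Γ Gv v x := by
  ext f
  constructor
  · intro h
    have key : ∀ e f, Relation.EqvGen (SideRel (gpCayley Γ Gv)) e f →
        (e ∈ hypEdges Γ Gv v x ↔ f ∈ hypEdges Γ Gv v x) := by
      intro e f h
      induction h with
      | rel e f h => exact ⟨mem_hypEdges_of_sideRel h, mem_hypEdges_of_sideRel h.symm'⟩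
      | refl e => rfl
      | symm e f _ ih => exact ih.symm
      | trans e f g _ _ ih1 ih2 => exact ih1.trans ih2
    refine (key _ _ h).1 (mem_hypEdges.2 ⟨?_, t, ht, rfl⟩)
    rw [mul_inv_cancel]; exact one_mem _
  · rintro ⟨p, s, hs, hp, rfl⟩
    have := eqvGen_of_mem_gpStar x ht hp s hs
    rwa [inv_mul_cancel_right] at this

/-- The distance in the contact graph. -/
noncomputable abbrev cdist (H K : Hyperplane (gpCayley Γ Gv)) : ℕ :=
  (contactGraph (gpCayley Γ Gv)).dist H K

theorem cdist_comm (H K : Hyperplane (gpCayley Γ Gv)) : cdist H K = cdist K H :=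
  SimpleGraph.dist_comm

theorem gpCayley_preconnected : (gpCayley Γ Gv).Preconnected := by
  have key : ∀ g x : GraphProduct Γ Gv, (gpCayley Γ Gv).Reachable x (g * x) := by
    intro g
    induction g using gp_induction with
    | one => intro x; rw [one_mul]
    | mul w s g ih =>
      intro x
      refine (ih x).trans ?_
      by_cases hs : s = 1
      · rw [hs, gpOf_one, one_mul]
      · exact (gpCayley_adj.2 ⟨w, s, hs, mul_assoc _ _ _⟩).reachable
  intro a b
  have := key (b * a⁻¹) a
  rwa [inv_mul_cancel_right] at this

theorem gpCayley_dist_mul_right_le (a b g : GraphProduct Γ Gv) :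
    (gpCayley Γ Gv).dist (a * g) (b * g) ≤ (gpCayley Γ Gv).dist a b := by
  obtain ⟨w, hw⟩ := (gpCayley_preconnected a b).exists_walk_length_eq_dist
  let f : gpCayley Γ Gv →g gpCayley Γ Gv :=
    ⟨fun x => x * g, fun {a b} h => by
      obtain ⟨v, s, hs, rfl⟩ := gpCayley_adj.1 h
      exact gpCayley_adj.2 ⟨v, s, hs, mul_assoc _ _ _⟩⟩
  rw [← hw, ← SimpleGraph.Walk.length_map f w]
  exact SimpleGraph.dist_le _

theorem gpCayley_dist_triangle (a b c : GraphProduct Γ Gv) :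
    (gpCayley Γ Gv).dist a c ≤ (gpCayley Γ Gv).dist a b + (gpCayley Γ Gv).dist b c :=
  haveI : Nonempty (GraphProduct Γ Gv) := ⟨a⟩
  (SimpleGraph.Connected.mk gpCayley_preconnected).dist_triangle

variable [∀ v, Nontrivial (Gv v)]

/-- The hyperplane labelled `v` that passes through `x`. -/
def hyp (v : ι) (x : GraphProduct Γ Gv) : Hyperplane (gpCayley Γ Gv) :=
  ⟨hypEdges Γ Gv v x, by
    obtain ⟨s, hs⟩ := exists_ne (1 : Gv v)
    exact ⟨s(x, gpOf Γ Gv v s * x), gpCayley_adj.2 ⟨v, s, hs, rfl⟩, (hypClass_eq x hs).symm⟩⟩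

theorem exists_eq_hyp (H : Hyperplane (gpCayley Γ Gv)) :
    ∃ q : ι × GraphProduct Γ Gv, H = hyp q.1 q.2 := by
  obtain ⟨H, e, he, rfl⟩ := H
  induction e using Sym2.ind with
  | _ a b =>
    have hab : (gpCayley Γ Gv).Adj a b := he
    obtain ⟨v, s, hs, rfl⟩ := gpCayley_adj.1 hab
    exact ⟨(v, a), Subtype.ext (hypClass_eq a hs)⟩

theorem hyp_eq_hyp {v w : ι} {x y : GraphProduct Γ Gv} :
    hyp v x = hyp w y ↔ v = w ∧ y * x⁻¹ ∈ gpStar Γ Gv v := by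
  constructor
  · intro h
    obtain ⟨s, hs⟩ := exists_ne (1 : Gv v)
    have hx : s(x, gpOf Γ Gv v s * x) ∈ (hyp v x).1 :=
      mem_hypEdges.2 ⟨by rw [mul_inv_cancel]; exact one_mem _, s, hs, rfl⟩
    rw [h] at hx
    obtain ⟨hxy, t, ht, hst⟩ := mem_hypEdges.1 hx
    obtain rfl := eq_of_gpOf_eq hs (mul_right_cancel hst)
    exact ⟨rfl, by simpa using inv_mem hxy⟩
  · rintro ⟨rfl, h⟩
    refine Subtype.ext (Set.ext fun e => ?_)
    induction e using Sym2.ind with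
    | _ a b =>
      change s(a, b) ∈ hypEdges Γ Gv v x ↔ s(a, b) ∈ hypEdges Γ Gv v y
      rw [mem_hypEdges, mem_hypEdges]
      have : a * x⁻¹ = a * y⁻¹ * (y * x⁻¹) := by group
      rw [this, (gpStar Γ Gv v).mul_mem_cancel_right h]

/-- The label of a hyperplane. -/
noncomputable def lbl (H : Hyperplane (gpCayley Γ Gv)) : ι := (exists_eq_hyp H).choose.1

/-- A vertex in the carrier of a hyperplane. -/
noncomputable def rep (H : Hyperplane (gpCayley Γ Gv)) : GraphProduct Γ Gv :=
  (exists_eq_hyp H).choose.2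

theorem hyp_lbl_rep (H : Hyperplane (gpCayley Γ Gv)) : hyp (lbl H) (rep H) = H :=
  (exists_eq_hyp H).choose_spec.symm

theorem lbl_hyp (v : ι) (x : GraphProduct Γ Gv) : lbl (hyp v x) = v :=
  (hyp_eq_hyp.1 (hyp_lbl_rep (hyp v x))).1

/-- The carrier of a hyperplane. -/
def nbh (H : Hyperplane (gpCayley Γ Gv)) : Set (GraphProduct Γ Gv) := {p | hyp (lbl H) p = H}

theorem mem_nbh {H : Hyperplane (gpCayley Γ Gv)} {p : GraphProduct Γ Gv} :
    p ∈ nbh H ↔ hyp (lbl H) p = H := Iff.rfl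

theorem mem_nbh_hyp {v : ι} {x p : GraphProduct Γ Gv} :
    p ∈ nbh (hyp v x) ↔ p * x⁻¹ ∈ gpStar Γ Gv v := by
  rw [mem_nbh, lbl_hyp, eq_comm, hyp_eq_hyp]; simp

theorem mem_nbh_self (v : ι) (x : GraphProduct Γ Gv) : x ∈ nbh (hyp v x) := by
  rw [mem_nbh, lbl_hyp]

theorem rep_mem_nbh (H : Hyperplane (gpCayley Γ Gv)) : rep H ∈ nbh H := hyp_lbl_rep H

theorem mul_inv_mem_of_mem_nbh {H : Hyperplane (gpCayley Γ Gv)} {p q : GraphProduct Γ Gv}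
    (hp : p ∈ nbh H) (hq : q ∈ nbh H) : p * q⁻¹ ∈ gpStar Γ Gv (lbl H) := by
  have := (hyp_eq_hyp.1 (mem_nbh.1 hq |>.trans (mem_nbh.1 hp).symm)).2
  exact this

theorem mem_nbh_of_mul_inv_mem {H : Hyperplane (gpCayley Γ Gv)} {p q : GraphProduct Γ Gv}
    (hq : q ∈ nbh H) (h : p * q⁻¹ ∈ gpStar Γ Gv (lbl H)) : p ∈ nbh H := by
  rw [mem_nbh, ← mem_nbh.1 hq, lbl_hyp, eq_comm, hyp_eq_hyp]
  exact ⟨rfl, h⟩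

theorem gpOf_mul_mem_nbh {H : Hyperplane (gpCayley Γ Gv)} {p : GraphProduct Γ Gv}
    (hp : p ∈ nbh H) {w : ι} (hw : w = lbl H ∨ Γ.Adj (lbl H) w) (s : Gv w) :
    gpOf Γ Gv w s * p ∈ nbh H :=
  mem_nbh_of_mul_inv_mem hp (by rw [mul_inv_cancel_right]; exact gpOf_mem_gpStar hw s)

theorem eq_of_mem_nbh {H K : Hyperplane (gpCayley Γ Gv)} {p : GraphProduct Γ Gv}
    (hH : p ∈ nbh H) (hK : p ∈ nbh K) (h : lbl H = lbl K) : H = K := by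
  rw [← mem_nbh.1 hH, ← mem_nbh.1 hK, h]

theorem mem_nbh_of_mem {H : Hyperplane (gpCayley Γ Gv)} {p a : GraphProduct Γ Gv}
    (h : s(p, a) ∈ H.1) : p ∈ nbh H := by
  obtain ⟨⟨v, x⟩, rfl⟩ := exists_eq_hyp H
  exact mem_nbh_hyp.2 (mem_hypEdges.1 h).1

/-- The carriers of `H` and `K` meet. -/
def Contact (H K : Hyperplane (gpCayley Γ Gv)) : Prop := ∃ p, p ∈ nbh H ∧ p ∈ nbh K

theorem Contact.symm {H K : Hyperplane (gpCayley Γ Gv)} (h : Contact H K) : Contact K H := by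
  obtain ⟨p, h1, h2⟩ := h
  exact ⟨p, h2, h1⟩

theorem contact_of_intersect_or_osculate {H K : Hyperplane (gpCayley Γ Gv)}
    (h : HypIntersect (gpCayley Γ Gv) H K ∨ HypOsculate (gpCayley Γ Gv) H K) : Contact H K := by
  rcases h with ⟨p, e, he, e', he', a, b, rfl, rfl, -⟩ | ⟨p, e, he, e', he', a, b, rfl, rfl, -⟩ <;>
  exact ⟨p, mem_nbh_of_mem he, mem_nbh_of_mem he'⟩

theorem contactGraph_adj {H K : Hyperplane (gpCayley Γ Gv)} :
    (contactGraph (gpCayley Γ Gv)).Adj H K ↔ H ≠ K ∧ Contact H K := by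
  rw [contactGraph, SimpleGraph.fromRel_adj]
  refine and_congr_right fun hne => ⟨?_, ?_⟩
  · rintro (h | h)
    · exact contact_of_intersect_or_osculate h
    · exact (contact_of_intersect_or_osculate h).symm
  · rintro ⟨p, hH, hK⟩
    left
    obtain ⟨s, hs⟩ := exists_ne (1 : Gv (lbl H))
    obtain ⟨t, ht⟩ := exists_ne (1 : Gv (lbl K))
    have hlbl : lbl K ≠ lbl H := fun h => hne (eq_of_mem_nbh hH hK h.symm)
    have mem : ∀ {L : Hyperplane (gpCayley Γ Gv)} {r : Gv (lbl L)}, p ∈ nbh L → r ≠ 1 →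
        s(p, gpOf Γ Gv (lbl L) r * p) ∈ L.1 := by
      intro L r hL hr
      have : s(p, gpOf Γ Gv (lbl L) r * p) ∈ (hyp (lbl L) p).1 :=
        mem_hypEdges.2 ⟨by rw [mul_inv_cancel]; exact one_mem _, r, hr, rfl⟩
      rwa [mem_nbh.1 hL] at this
    have hab : gpOf Γ Gv (lbl H) s * p ≠ gpOf Γ Gv (lbl K) t * p :=
      fun h => hlbl (eq_of_gpOf_eq hs (mul_right_cancel h))
    have hnadj : ¬ (gpCayley Γ Gv).Adj (gpOf Γ Gv (lbl H) s * p) (gpOf Γ Gv (lbl K) t * p) := by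
      rw [gpCayley_adj]
      rintro ⟨u, r, -, h⟩
      rw [← mul_assoc, mul_left_inj] at h
      exact hlbl (eq_of_gpOf_eq_mul hs ht h)
    by_cases hq : ∃ q, q ≠ p ∧ (gpCayley Γ Gv).Adj (gpOf Γ Gv (lbl H) s * p) q ∧
        (gpCayley Γ Gv).Adj (gpOf Γ Gv (lbl K) t * p) q
    · exact Or.inl ⟨p, _, mem hH hs, _, mem hK ht, _, _, rfl, rfl, gpCayley_adj.2 ⟨_, s, hs, rfl⟩,
        gpCayley_adj.2 ⟨_, t, ht, rfl⟩, hab, hnadj, hq⟩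
    · exact Or.inr ⟨p, _, mem hH hs, _, mem hK ht, _, _, rfl, rfl, gpCayley_adj.2 ⟨_, s, hs, rfl⟩,
        gpCayley_adj.2 ⟨_, t, ht, rfl⟩, hab, hnadj, hq⟩

theorem Contact.reachable {H K : Hyperplane (gpCayley Γ Gv)} (h : Contact H K) :
    (contactGraph (gpCayley Γ Gv)).Reachable H K := by
  by_cases hne : H = K
  · rw [hne]
  · exact (contactGraph_adj.2 ⟨hne, h⟩).reachable

theorem contactGraph_preconnected : (contactGraph (gpCayley Γ Gv)).Preconnected := by
  have key : ∀ (g : GraphProduct Γ Gv) (w v : ι) (x : GraphProduct Γ Gv),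
      (contactGraph (gpCayley Γ Gv)).Reachable (hyp v x) (hyp w (g * x)) := by
    intro g
    induction g using gp_induction with
    | one =>
      intro w v x
      rw [one_mul]
      exact Contact.reachable ⟨x, mem_nbh_self v x, mem_nbh_self w x⟩
    | mul u s g ih =>
      intro w v x
      refine (ih u v x).trans (Contact.reachable ⟨gpOf Γ Gv u s * g * x, ?_, mem_nbh_self _ _⟩)
      rw [mul_assoc]
      exact gpOf_mul_mem_nbh (mem_nbh_self _ _) (Or.inl (lbl_hyp _ _).symm) s
  intro H K
  rw [← hyp_lbl_rep H, ← hyp_lbl_rep K]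
  have := key (rep K * (rep H)⁻¹) (lbl K) (lbl H) (rep H)
  rwa [inv_mul_cancel_right] at this

theorem cdist_triangle (H K L : Hyperplane (gpCayley Γ Gv)) :
    cdist H L ≤ cdist H K + cdist K L :=
  haveI : Nonempty (Hyperplane (gpCayley Γ Gv)) := ⟨H⟩
  (SimpleGraph.Connected.mk contactGraph_preconnected).dist_triangle

theorem Contact.cdist_le {H K : Hyperplane (gpCayley Γ Gv)} (h : Contact H K) : cdist H K ≤ 1 := by
  by_cases hne : H = K
  · rw [hne, cdist, SimpleGraph.dist_self]; exact zero_le_one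
  · exact (SimpleGraph.dist_eq_one_iff_adj.2 (contactGraph_adj.2 ⟨hne, h⟩)).le

/-- The translate of a hyperplane under the right action. -/
noncomputable def tr (g : GraphProduct Γ Gv) (H : Hyperplane (gpCayley Γ Gv)) :
    Hyperplane (gpCayley Γ Gv) := hyp (lbl H) (rep H * g)

theorem lbl_tr (g : GraphProduct Γ Gv) (H : Hyperplane (gpCayley Γ Gv)) : lbl (tr g H) = lbl H :=
  lbl_hyp _ _

theorem mem_nbh_tr {g p : GraphProduct Γ Gv} {H : Hyperplane (gpCayley Γ Gv)} :
    p * g ∈ nbh (tr g H) ↔ p ∈ nbh H := by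
  rw [tr, mem_nbh_hyp]
  have : p * g * (rep H * g)⁻¹ = p * (rep H)⁻¹ := by group
  rw [this]
  exact ⟨mem_nbh_of_mul_inv_mem (rep_mem_nbh H), fun h => mul_inv_mem_of_mem_nbh h (rep_mem_nbh H)⟩

theorem tr_hyp (g : GraphProduct Γ Gv) (v : ι) (x : GraphProduct Γ Gv) :
    tr g (hyp v x) = hyp v (x * g) :=
  eq_of_mem_nbh (mem_nbh_tr.2 (mem_nbh_self v x)) (mem_nbh_self _ _) (by simp [lbl_tr, lbl_hyp])

theorem tr_tr (g h : GraphProduct Γ Gv) (H : Hyperplane (gpCayley Γ Gv)) :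
    tr h (tr g H) = tr (g * h) H := by
  obtain ⟨⟨v, x⟩, rfl⟩ := exists_eq_hyp H
  simp [tr_hyp, mul_assoc]

theorem tr_one (H : Hyperplane (gpCayley Γ Gv)) : tr 1 H = H := by
  obtain ⟨⟨v, x⟩, rfl⟩ := exists_eq_hyp H
  simp [tr_hyp]

theorem tr_inv_tr (g : GraphProduct Γ Gv) (H : Hyperplane (gpCayley Γ Gv)) :
    tr g⁻¹ (tr g H) = H := by rw [tr_tr, mul_inv_cancel, tr_one]

theorem tr_tr_inv (g : GraphProduct Γ Gv) (H : Hyperplane (gpCayley Γ Gv)) :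
    tr g (tr g⁻¹ H) = H := by rw [tr_tr, inv_mul_cancel, tr_one]

theorem tr_injective (g : GraphProduct Γ Gv) :
    Function.Injective (tr g : Hyperplane (gpCayley Γ Gv) → _) := fun H K h => by
  rw [← tr_inv_tr g H, h, tr_inv_tr]

theorem Contact.tr {H K : Hyperplane (gpCayley Γ Gv)} (h : Contact H K)
    (g : GraphProduct Γ Gv) : Contact (tr g H) (tr g K) := by
  obtain ⟨p, h1, h2⟩ := h
  exact ⟨p * g, mem_nbh_tr.2 h1, mem_nbh_tr.2 h2⟩

theorem cdist_tr_le (g : GraphProduct Γ Gv) (H K : Hyperplane (gpCayley Γ Gv)) :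
    cdist (tr g H) (tr g K) ≤ cdist H K := by
  obtain ⟨w, hw⟩ := (contactGraph_preconnected H K).exists_walk_length_eq_dist
  let f : contactGraph (gpCayley Γ Gv) →g contactGraph (gpCayley Γ Gv) :=
    ⟨tr g, fun {a b} h => by
      rw [contactGraph_adj] at h ⊢
      exact ⟨fun h' => h.1 (tr_injective g h'), h.2.tr g⟩⟩
  rw [cdist, cdist, ← hw, ← SimpleGraph.Walk.length_map f w]
  exact SimpleGraph.dist_le _

theorem cdist_tr (g : GraphProduct Γ Gv) (H K : Hyperplane (gpCayley Γ Gv)) :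
    cdist (tr g H) (tr g K) = cdist H K := by
  refine le_antisymm (cdist_tr_le g H K) ?_
  have := cdist_tr_le g⁻¹ (tr g H) (tr g K)
  rwa [tr_inv_tr, tr_inv_tr] at this

theorem tr_val (g : GraphProduct Γ Gv) (H : Hyperplane (gpCayley Γ Gv)) :
    (tr g H).1 = Sym2.map (fun x => x * g) '' H.1 := by
  obtain ⟨⟨v, x⟩, rfl⟩ := exists_eq_hyp H
  rw [tr_hyp]
  ext e
  constructor
  · rintro ⟨p, s, hs, hp, rfl⟩
    refine ⟨s(p * g⁻¹, gpOf Γ Gv v s * (p * g⁻¹)), mem_hypEdges.2 ⟨?_, s, hs, rfl⟩, ?_⟩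
    · rwa [mul_inv_rev, ← mul_assoc] at hp
    · simp [mul_assoc]
  · rintro ⟨_, ⟨p, s, hs, hp, rfl⟩, rfl⟩
    refine ⟨p * g, s, hs, ?_, by simp [mul_assoc]⟩
    rwa [mul_inv_rev, ← mul_assoc, mul_inv_cancel_right]

theorem gpTranslateDistLE_iff {g : GraphProduct Γ Gv} {A : Hyperplane (gpCayley Γ Gv)} {ε : ℝ} :
    gpTranslateDistLE Γ Gv g A ε ↔ (cdist A (tr g A) : ℝ) ≤ ε := by
  constructor
  · rintro ⟨A', h, hd⟩
    have : A' = tr g A := Subtype.ext (h.trans (tr_val g A).symm)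
    rwa [this] at hd
  · exact fun h => ⟨tr g A, tr_val g A, h⟩

end Hyperplanes

section Separation

variable {ι : Type*} {Γ : SimpleGraph ι} {Gv : ι → Type*} [∀ v, Group (Gv v)]
  [∀ v, Nontrivial (Gv v)]

/-- The hyperplane `H` separates the vertices `a` and `b`: they lie in different sectors. -/
def Sep (H : Hyperplane (gpCayley Γ Gv)) (a b : GraphProduct Γ Gv) : Prop :=
  sector (lbl H) (a * (rep H)⁻¹) ≠ sector (lbl H) (b * (rep H)⁻¹)

theorem sep_iff {H : Hyperplane (gpCayley Γ Gv)} {q : GraphProduct Γ Gv} (hq : q ∈ nbh H) {v : ι}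
    (hv : lbl H = v) (a b : GraphProduct Γ Gv) :
    Sep H a b ↔ sector v (a * q⁻¹) ≠ sector v (b * q⁻¹) := by
  subst hv
  have h := mul_inv_mem_of_mem_nbh hq (rep_mem_nbh H)
  have key : ∀ x : GraphProduct Γ Gv, sector (lbl H) (x * (rep H)⁻¹) =
      sector (lbl H) (x * q⁻¹) * sector (lbl H) (q * (rep H)⁻¹) := fun x => by
    rw [← sector_mul_of_mem _ h]; congr 1; group
  rw [Sep, key a, key b, Ne, mul_left_inj]

theorem not_sep_self (H : Hyperplane (gpCayley Γ Gv)) (a : GraphProduct Γ Gv) : ¬ Sep H a a :=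
  fun h => h rfl

theorem Sep.symm {H : Hyperplane (gpCayley Γ Gv)} {a b : GraphProduct Γ Gv} (h : Sep H a b) :
    Sep H b a := Ne.symm h

theorem sep_comm {H : Hyperplane (gpCayley Γ Gv)} {a b : GraphProduct Γ Gv} :
    Sep H a b ↔ Sep H b a := ⟨Sep.symm, Sep.symm⟩

theorem Sep.or {H : Hyperplane (gpCayley Γ Gv)} {a b : GraphProduct Γ Gv} (h : Sep H a b)
    (c : GraphProduct Γ Gv) : Sep H a c ∨ Sep H c b := by
  by_contra! hn
  exact h ((not_not.1 hn.1).trans (not_not.1 hn.2))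

theorem sep_congr_right {H : Hyperplane (gpCayley Γ Gv)} {b c : GraphProduct Γ Gv}
    (h : ¬ Sep H b c) (a : GraphProduct Γ Gv) : Sep H a b ↔ Sep H a c :=
  ⟨fun h' => (h'.or c).resolve_right fun h'' => h h''.symm,
    fun h' => (h'.or b).resolve_right h⟩

theorem sep_congr_left {H : Hyperplane (gpCayley Γ Gv)} {b c : GraphProduct Γ Gv}
    (h : ¬ Sep H b c) (a : GraphProduct Γ Gv) : Sep H b a ↔ Sep H c a := by
  rw [sep_comm, sep_congr_right h, sep_comm]

theorem sep_tr {g : GraphProduct Γ Gv} {H : Hyperplane (gpCayley Γ Gv)}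
    {a b : GraphProduct Γ Gv} : Sep (tr g H) (a * g) (b * g) ↔ Sep H a b := by
  rw [sep_iff (mem_nbh_tr.2 (rep_mem_nbh H)) (lbl_tr g H), Sep]
  have h : ∀ x : GraphProduct Γ Gv, x * g * (rep H * g)⁻¹ = x * (rep H)⁻¹ := fun x => by group
  rw [h, h]

theorem sep_gpOf_mul {H : Hyperplane (gpCayley Γ Gv)} {a : GraphProduct Γ Gv} {w : ι} {s : Gv w} :
    Sep H a (gpOf Γ Gv w s * a) ↔ s ≠ 1 ∧ w = lbl H ∧ a ∈ nbh H := by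
  by_cases h : w = lbl H ∧ a ∈ nbh H
  · obtain ⟨rfl, ha⟩ := h
    rw [sep_iff ha rfl, mul_inv_cancel_right, mul_inv_cancel, sector_one]
    rw [← mul_one (gpOf Γ Gv _ s), sector_of_mul_of_mem s (one_mem _), sector_one, mul_one]
    simp [ha, eq_comm]
  · simp only [h, and_false, iff_false, Sep, not_not, mul_assoc]
    rw [sector_of_mul_of_not]
    rintro ⟨rfl, h'⟩
    exact h ⟨rfl, mem_nbh_of_mul_inv_mem (rep_mem_nbh H) h'⟩

theorem contact_of_sep {H K : Hyperplane (gpCayley Γ Gv)} {a b : GraphProduct Γ Gv}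
    (ha : a ∈ nbh K) (hb : b ∈ nbh K) (h : Sep H a b) :
    Contact H K ∧ (lbl H = lbl K ∨ Γ.Adj (lbl K) (lbl H)) := by
  have key : ∀ k ∈ gpStar Γ Gv (lbl K), Sep H a (k * a) →
      Contact H K ∧ (lbl H = lbl K ∨ Γ.Adj (lbl K) (lbl H)) := by
    intro k hk
    induction hk using gpStar_induction with
    | one => intro h; rw [one_mul] at h; exact absurd h (not_sep_self _ _)
    | mul w s g hw hg ih =>
      intro h
      rcases h.or (g * a) with h | h
      · exact ih h
      · rw [mul_assoc, sep_gpOf_mul] at h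
        obtain ⟨-, rfl, hH⟩ := h
        refine ⟨⟨g * a, hH, mem_nbh_of_mul_inv_mem ha ?_⟩, hw⟩
        rwa [mul_inv_cancel_right]
  apply key _ (mul_inv_mem_of_mem_nbh hb ha)
  rwa [inv_mul_cancel_right]

theorem not_sep_of_mem_nbh {H K : Hyperplane (gpCayley Γ Gv)} (hne : H ≠ K)
    (hadj : ¬ Γ.Adj (lbl K) (lbl H)) {a b : GraphProduct Γ Gv}
    (ha : a ∈ nbh K) (hb : b ∈ nbh K) : ¬ Sep H a b := by
  intro h
  obtain ⟨⟨p, h1, h2⟩, h3⟩ := contact_of_sep ha hb h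
  exact hne (eq_of_mem_nbh h1 h2 (h3.resolve_right hadj))

/-- An element stabilising `H` either preserves every sector or moves every vertex to a
different sector. -/
theorem sep_mul_of_tr_eq {f : GraphProduct Γ Gv} {H : Hyperplane (gpCayley Γ Gv)} (hf : tr f H = H)
    (q q' : GraphProduct Γ Gv) : Sep H q (q * f) ↔ Sep H q' (q' * f) := by
  have h : rep H * f * (rep H)⁻¹ ∈ gpStar Γ Gv (lbl H) := by
    refine mul_inv_mem_of_mem_nbh ?_ (rep_mem_nbh H)
    have := (mem_nbh_tr (g := f)).2 (rep_mem_nbh H)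
    rwa [hf] at this
  have key : ∀ x : GraphProduct Γ Gv, Sep H x (x * f) ↔
      sector (lbl H) (rep H * f * (rep H)⁻¹) ≠ 1 := fun x => by
    have : x * f * (rep H)⁻¹ = x * (rep H)⁻¹ * (rep H * f * (rep H)⁻¹) := by group
    rw [Sep, this, sector_mul_of_mem _ h, Ne, eq_comm, mul_eq_left]
  rw [key, key]

/-- A geodesic of the Cayley graph from `a` to `b`, together with the hyperplanes it crosses. -/
structure GeodPath (a b : GraphProduct Γ Gv) where
  /-- The length. -/
  n : ℕ
  /-- The vertices. -/
  q : ℕ → GraphProduct Γ Gv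
  /-- The hyperplanes crossed. -/
  E : ℕ → Hyperplane (gpCayley Γ Gv)
  q_zero : q 0 = a
  q_n : q n = b
  mem : ∀ i < n, q i ∈ nbh (E i)
  step : ∀ i < n, ∃ s : Gv (lbl (E i)), q (i + 1) = gpOf Γ Gv (lbl (E i)) s * q i
  inj : ∀ i < n, ∀ j < n, E i = E j → i = j
  sep : ∀ H i j, i ≤ j → j ≤ n → (Sep H (q i) (q j) ↔ ∃ k, i ≤ k ∧ k < j ∧ H = E k)

theorem not_sep_of_forall_ne {n : ℕ} {q : ℕ → GraphProduct Γ Gv}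
    {E : ℕ → Hyperplane (gpCayley Γ Gv)} (mem : ∀ i < n, q i ∈ nbh (E i))
    (step : ∀ i < n, ∃ s : Gv (lbl (E i)), q (i + 1) = gpOf Γ Gv (lbl (E i)) s * q i)
    {H : Hyperplane (gpCayley Γ Gv)} {i j : ℕ} (hij : i ≤ j) (hj : j ≤ n)
    (h : ∀ k, i ≤ k → k < j → E k ≠ H) : ¬ Sep H (q i) (q j) := by
  induction j, hij using Nat.le_induction with
  | base => exact not_sep_self _ _
  | succ j hij ih =>
    intro hs
    rcases hs.or (q j) with hs | hs
    · exact ih (by omega) (fun k h1 h2 => h k h1 (by omega)) hs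
    · obtain ⟨s, e⟩ := step j (by omega)
      rw [e, sep_gpOf_mul] at hs
      exact h j hij (by omega) (eq_of_mem_nbh (mem j (by omega)) hs.2.2 hs.2.1)

theorem exists_geodPath (H₀ : Hyperplane (gpCayley Γ Gv)) (a b : GraphProduct Γ Gv) :
    Nonempty (GeodPath a b) := by
  obtain ⟨w, hw⟩ := (gpCayley_preconnected a b).exists_walk_length_eq_dist
  obtain ⟨n, hn⟩ : ∃ n, n = w.length := ⟨_, rfl⟩
  have hex : ∀ i, ∃ H : Hyperplane (gpCayley Γ Gv), i < n → w.getVert i ∈ nbh H ∧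
      ∃ s : Gv (lbl H), s ≠ 1 ∧ w.getVert (i + 1) = gpOf Γ Gv (lbl H) s * w.getVert i := by
    intro i
    by_cases hi : i < n
    · obtain ⟨v, s, hs, h⟩ := gpCayley_adj.1 (w.adj_getVert_succ (hn ▸ hi))
      refine ⟨hyp v (w.getVert i), fun _ => ⟨mem_nbh_self _ _, ?_⟩⟩
      rw [lbl_hyp]
      exact ⟨s, hs, h⟩
    · exact ⟨H₀, fun h => absurd h hi⟩
  choose E hE using hex
  have h0 : w.getVert 0 = a := w.getVert_zero
  have hn' : w.getVert n = b := by rw [hn]; exact w.getVert_length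
  rw [← hn] at hw
  generalize w.getVert = q at *
  have mem : ∀ i < n, q i ∈ nbh (E i) := fun i hi => (hE i hi).1
  have step : ∀ i < n, ∃ s : Gv (lbl (E i)), q (i + 1) = gpOf Γ Gv (lbl (E i)) s * q i :=
    fun i hi => (hE i hi).2.imp fun s hs => hs.2
  have dist_le : ∀ i j, i ≤ j → j ≤ n → (gpCayley Γ Gv).dist (q i) (q j) ≤ j - i := by
    intro i j hij
    induction j, hij using Nat.le_induction with
    | base => simp
    | succ j hij ih =>
      intro hj
      obtain ⟨s, hs, h⟩ := (hE j (by omega)).2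
      have h1 := SimpleGraph.dist_eq_one_iff_adj.2 (gpCayley_adj.2 ⟨_, s, hs, h⟩)
      have h2 := gpCayley_dist_triangle (q i) (q j) (q (j + 1))
      have h3 := ih (by omega)
      omega
  have le_dist : ∀ i j, i ≤ j → j ≤ n → j - i ≤ (gpCayley Γ Gv).dist (q i) (q j) := by
    intro i j hij hj
    have h1 := gpCayley_dist_triangle a (q i) b
    have h2 := gpCayley_dist_triangle (q i) (q j) b
    have h3 := dist_le 0 i (by omega) (by omega)
    have h4 := dist_le j n (by omega) le_rfl
    rw [h0] at h3
    rw [hn'] at h4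
    omega
  have ne : ∀ d i j, j = i + d + 1 → j < n → E i ≠ E j := by
    intro d
    induction d using Nat.strong_induction_on with
    | _ d ih =>
      intro i j hij hj heq
      have hns : ¬ Sep (E i) (q (i + 1)) (q j) := by
        refine not_sep_of_forall_ne mem step (by omega) (by omega) fun k h1 h2 h3 => ?_
        exact ih (k - i - 1) (by omega) i k (by omega) (by omega) h3.symm
      obtain ⟨s, hs, hqi⟩ := (hE i (by omega)).2
      obtain ⟨t, ht, hqj⟩ := (hE j hj).2
      have hmi : q i ∈ nbh (E i) := mem i (by omega)
      have hmj := mem j hj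
      rw [← heq] at hmj
      have hmi1 : q (i + 1) ∈ nbh (E i) := by
        rw [hqi]; exact gpOf_mul_mem_nbh hmi (Or.inl rfl) s
      obtain ⟨v, hv⟩ : ∃ v, lbl (E i) = v := ⟨_, rfl⟩
      rw [← heq] at t
      have hk := mul_inv_mem_of_mem_nbh hmj hmi1
      rw [sep_iff hmi1 hv, mul_inv_cancel, sector_one, not_not] at hns
      have hcomm : ∀ r : Gv v, gpOf Γ Gv v r * (q j * (q (i + 1))⁻¹) =
        (q j * (q (i + 1))⁻¹) * gpOf Γ Gv v r := gpOf_comm_of_sector_eq_one (hv ▸ hk) hns.symm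
      obtain ⟨s', hs'⟩ : ∃ s' : Gv v, gpOf Γ Gv (lbl (E i)) s = gpOf Γ Gv v s' := by
        subst hv; exact ⟨s, rfl⟩
      obtain ⟨t', ht'⟩ : ∃ t' : Gv v, q (j + 1) = gpOf Γ Gv v t' * q j := by
        subst hv; rw [heq]; exact ⟨_, hqj⟩
      have h1 : q (j + 1) = q j * (q (i + 1))⁻¹ * (gpOf Γ Gv v (t' * s') * q i) := by
        rw [ht', gpOf_mul, mul_assoc (gpOf Γ Gv v t'), ← hs', ← hqi, ← mul_assoc, ← hcomm]
        group
      have h2 : (gpCayley Γ Gv).dist (q i) (gpOf Γ Gv v (t' * s') * q i) ≤ 1 := by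
        by_cases h : t' * s' = 1
        · rw [h, gpOf_one, one_mul, SimpleGraph.dist_self]; omega
        · exact (SimpleGraph.dist_eq_one_iff_adj.2 (gpCayley_adj.2 ⟨v, _, h, rfl⟩)).le
      have h3 := gpCayley_dist_triangle (q i) (gpOf Γ Gv v (t' * s') * q i) (q (j + 1))
      have h4 := gpCayley_dist_mul_right_le (q (i + 1)) (q j)
        ((q (i + 1))⁻¹ * (gpOf Γ Gv v (t' * s') * q i))
      rw [mul_inv_cancel_left, ← mul_assoc, ← h1] at h4
      have h5 := dist_le (i + 1) j (by omega) (by omega)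
      have h6 := le_dist i (j + 1) (by omega) (by omega)
      omega
  have inj : ∀ i < n, ∀ j < n, E i = E j → i = j := by
    intro i hi j hj h
    rcases lt_trichotomy i j with hlt | heq | hlt
    · exact absurd h (ne (j - i - 1) i j (by omega) hj)
    · exact heq
    · exact absurd h.symm (ne (i - j - 1) j i (by omega) hi)
  refine ⟨⟨n, q, E, h0, hn', mem, step, inj, fun H i j hij hj => ⟨fun h => ?_, ?_⟩⟩⟩
  · by_contra! hne
    exact not_sep_of_forall_ne mem step hij hj (fun k h1 h2 => (hne k h1 h2).symm) h
  · rintro ⟨k, hik, hkj, rfl⟩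
    obtain ⟨s, hs, hq⟩ := (hE k (by omega)).2
    have h1 : Sep (E k) (q k) (q (k + 1)) := by
      rw [hq, sep_gpOf_mul]; exact ⟨hs, rfl, mem k (by omega)⟩
    have h2 : ¬ Sep (E k) (q i) (q k) := not_sep_of_forall_ne mem step hik (by omega)
      fun m hm1 hm2 h => by have := inj m (by omega) k (by omega) h; omega
    have h3 : ¬ Sep (E k) (q (k + 1)) (q j) := not_sep_of_forall_ne mem step (by omega) hj
      fun m hm1 hm2 h => by have := inj m (by omega) k (by omega) h; omega
    rw [sep_congr_left h2, ← sep_congr_right h3]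
    exact h1

theorem GeodPath.mem_succ {a b : GraphProduct Γ Gv} (P : GeodPath a b) {i : ℕ} (hi : i < P.n) :
    P.q (i + 1) ∈ nbh (P.E i) := by
  obtain ⟨s, hs⟩ := P.step i hi
  rw [hs]
  exact gpOf_mul_mem_nbh (P.mem i hi) (Or.inl rfl) s

theorem GeodPath.sep_ends {a b : GraphProduct Γ Gv} (P : GeodPath a b)
    {H : Hyperplane (gpCayley Γ Gv)} : Sep H a b ↔ ∃ k < P.n, H = P.E k := by
  have := P.sep H 0 P.n (by omega) le_rfl
  rw [P.q_zero, P.q_n] at this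
  rw [this]
  exact exists_congr fun k => by simp

theorem GeodPath.cdist_succ_le {a b : GraphProduct Γ Gv} (P : GeodPath a b) {i : ℕ}
    (hi : i + 1 < P.n) : cdist (P.E i) (P.E (i + 1)) ≤ 1 :=
  Contact.cdist_le ⟨P.q (i + 1), P.mem_succ (by omega), P.mem (i + 1) hi⟩

theorem eq_of_forall_not_sep (H₀ : Hyperplane (gpCayley Γ Gv)) {a b : GraphProduct Γ Gv}
    (h : ∀ H : Hyperplane (gpCayley Γ Gv), ¬ Sep H a b) : a = b := by
  obtain ⟨P⟩ := exists_geodPath H₀ a b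
  have hn : P.n = 0 := by
    by_contra hn
    exact h (P.E 0) (P.sep_ends.2 ⟨0, by omega, rfl⟩)
  rw [← P.q_n, hn, P.q_zero]

/-- A hyperplane separating vertices in the carriers of the endpoints of a walk in the contact
graph is in contact with a hyperplane on the walk. -/
theorem exists_contact_of_walk {H H' : Hyperplane (gpCayley Γ Gv)}
    (w : (contactGraph (gpCayley Γ Gv)).Walk H H') {J : Hyperplane (gpCayley Γ Gv)}
    {p p' : GraphProduct Γ Gv} (hp : p ∈ nbh H) (hp' : p' ∈ nbh H') (h : Sep J p p') :
    ∃ K ∈ w.support, Contact J K ∧ (lbl J = lbl K ∨ Γ.Adj (lbl K) (lbl J)) := by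
  induction w generalizing p with
  | nil => exact ⟨_, SimpleGraph.Walk.start_mem_support _, contact_of_sep hp hp' h⟩
  | @cons A B C hadj w ih =>
    obtain ⟨r, hr, hr'⟩ := (contactGraph_adj.1 hadj).2
    rcases h.or r with h | h
    · exact ⟨_, SimpleGraph.Walk.start_mem_support _, contact_of_sep hp hr h⟩
    · obtain ⟨K, hK, h'⟩ := ih hr' hp' h
      exact ⟨K, by simp [hK], h'⟩

/-- A hyperplane separating vertices of two carriers is in contact with a hyperplane on a geodesic
of the contact graph. -/
theorem exists_contact_of_sep {A B J : Hyperplane (gpCayley Γ Gv)} {p p' : GraphProduct Γ Gv}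
    (hp : p ∈ nbh A) (hp' : p' ∈ nbh B) (h : Sep J p p') :
    ∃ K, Contact J K ∧ cdist A K + cdist K B = cdist A B := by
  classical
  obtain ⟨w, hw⟩ := (contactGraph_preconnected A B).exists_walk_length_eq_dist
  obtain ⟨K, hK, hJK, -⟩ := exists_contact_of_walk w hp hp' h
  refine ⟨K, hJK, le_antisymm ?_ (cdist_triangle A K B)⟩
  have h1 := congrArg SimpleGraph.Walk.length (w.take_spec hK)
  rw [SimpleGraph.Walk.length_append] at h1
  have h2 := SimpleGraph.dist_le (w.takeUntil K hK)
  have h3 := SimpleGraph.dist_le (w.dropUntil K hK)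
  unfold cdist
  omega

end Separation

section QuasiTree

theorem isQuasiTreeGraph_of_bottleneck {W : Type u} (Y : SimpleGraph W) (hY : Y.Preconnected)
    (Δ : ℕ) (h : ∀ (o x y : W) (w : Y.Walk x y), Y.dist o x = Y.dist o y →
      (∀ z ∈ w.support, Y.dist o x ≤ Y.dist o z) → Y.dist x y ≤ Δ) : IsQuasiTreeGraph Y := by
  classical
  rcases isEmpty_or_nonempty W with hW | hW
  · exact ⟨W, ⊥, SimpleGraph.isAcyclic_bot, fun a => hW.elim a, id, 1, 0, one_pos, le_rfl,
      fun a => hW.elim a, fun a => hW.elim a⟩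
  obtain ⟨o⟩ := id hW
  have hconn : Y.Connected := ⟨hY⟩
  have lev_le : ∀ {x y}, Y.Adj x y → Y.dist o y ≤ Y.dist o x + 1 := fun {x y} hxy => by
    have := hconn.dist_triangle (u := o) (v := x) (w := y)
    rwa [SimpleGraph.dist_eq_one_iff_adj.2 hxy] at this
  let S : Setoid W :=
    { r := fun x y => Y.dist o x = Y.dist o y ∧
        ∃ w : Y.Walk x y, ∀ z ∈ w.support, Y.dist o x ≤ Y.dist o z
      iseqv :=
        { refl := fun x => ⟨rfl, .nil, by simp⟩
          symm := fun {x y} ⟨e, w, hw⟩ => ⟨e.symm, w.reverse, fun z hz => by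
            rw [SimpleGraph.Walk.support_reverse, List.mem_reverse] at hz
            exact e ▸ hw z hz⟩
          trans := fun {x y z} ⟨e, w, hw⟩ ⟨e', w', hw'⟩ => ⟨e.trans e', w.append w', fun t ht => by
            rw [SimpleGraph.Walk.mem_support_append_iff] at ht
            rcases ht with ht | ht
            · exact hw t ht
            · exact e ▸ hw' t ht⟩ } }
  let ht : Quotient S → ℕ := Quotient.lift (fun x => Y.dist o x) (fun _ _ hab => hab.1)
  let Tr : SimpleGraph (Quotient S) :=
    { Adj := fun s t => s ≠ t ∧ ∃ x y, Y.Adj x y ∧ Quotient.mk S x = s ∧ Quotient.mk S y = t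
      symm := ⟨fun s t ⟨hne, x, y, hxy, hx, hy⟩ => ⟨hne.symm, y, x, hxy.symm, hy, hx⟩⟩
      loopless := ⟨fun s hs => hs.1 rfl⟩ }
  have Tr_adj : ∀ {s t}, Tr.Adj s t ↔
      s ≠ t ∧ ∃ x y, Y.Adj x y ∧ Quotient.mk S x = s ∧ Quotient.mk S y = t := Iff.rfl
  have hle : ∀ {s t}, Tr.Adj s t → ht s ≤ ht t + 1 := by
    rintro _ _ ⟨-, x, y, hxy, rfl, rfl⟩
    exact lev_le hxy.symm
  have hne : ∀ {s t}, Tr.Adj s t → ht s ≠ ht t := by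
    rintro _ _ ⟨hne, x, y, hxy, rfl, rfl⟩ he
    refine hne (Quotient.sound ⟨he, hxy.toWalk, ?_⟩)
    have he : Y.dist o x = Y.dist o y := he
    simp [he]
  have huniq : ∀ {s t t'}, Tr.Adj s t → Tr.Adj s t' → ht t ≤ ht s → ht t' ≤ ht s → t = t' := by
    intro s t t' h1 h2 h3 h4
    have e1 := hle h1
    have e2 := hle h2
    have e3 := hne h1
    have e4 := hne h2
    obtain ⟨-, x, y, hxy, rfl, rfl⟩ := h1
    obtain ⟨-, x', y', hxy', hx', rfl⟩ := h2
    obtain ⟨e, w, hw⟩ := Quotient.exact hx'.symm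
    change Y.dist o x ≤ Y.dist o y + 1 at e1
    change Y.dist o x ≤ Y.dist o y' + 1 at e2
    change Y.dist o x ≠ Y.dist o y at e3
    change Y.dist o x ≠ Y.dist o y' at e4
    change Y.dist o y ≤ Y.dist o x at h3
    change Y.dist o y' ≤ Y.dist o x at h4
    refine Quotient.sound ⟨show Y.dist o y = Y.dist o y' by omega,
      .cons hxy.symm (w.append hxy'.toWalk), ?_⟩
    intro z hz
    rw [SimpleGraph.Walk.support_cons, List.mem_cons,
      SimpleGraph.Walk.mem_support_append_iff] at hz
    rcases hz with rfl | hz | hz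
    · exact le_rfl
    · have := hw z hz; omega
    · have : z = x' ∨ z = y' := by simpa using hz
      rcases this with rfl | rfl <;> omega
  have hreach : ∀ {x y} (w : Y.Walk x y), Tr.Reachable (Quotient.mk S x) (Quotient.mk S y) := by
    intro x y w
    induction w with
    | nil => rfl
    | @cons a b c hab w ih =>
      refine SimpleGraph.Reachable.trans ?_ ih
      by_cases e : Quotient.mk S a = Quotient.mk S b
      · rw [e]
      · exact SimpleGraph.Adj.reachable (Tr_adj.2 ⟨e, a, b, hab, rfl, rfl⟩)
  have hpre : Tr.Preconnected := by
    intro s t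
    induction s using Quotient.ind with | _ x => ?_
    induction t using Quotient.ind with | _ y => ?_
    exact hreach (hY x y).some
  have : Nonempty (Quotient S) := ⟨Quotient.mk S o⟩
  have hTc : Tr.Connected := ⟨hpre⟩
  have hlip : ∀ {x y} (w : Y.Walk x y), Tr.dist (Quotient.mk S x) (Quotient.mk S y) ≤ w.length := by
    intro x y w
    induction w with
    | nil => simp
    | @cons a b c hab w ih =>
      have h1 : Tr.dist (Quotient.mk S a) (Quotient.mk S b) ≤ 1 := by
        by_cases e : Quotient.mk S a = Quotient.mk S b
        · rw [e, SimpleGraph.dist_self]; exact zero_le_one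
        · exact (SimpleGraph.dist_eq_one_iff_adj.2 (Tr_adj.2 ⟨e, a, b, hab, rfl, rfl⟩)).le
      have h2 := hTc.dist_triangle (u := Quotient.mk S a) (v := Quotient.mk S b)
        (w := Quotient.mk S c)
      rw [SimpleGraph.Walk.length_cons]
      omega
  have hclass : ∀ {x y}, Quotient.mk S x = Quotient.mk S y → Y.dist x y ≤ Δ := by
    intro x y hxy
    obtain ⟨e, w, hw⟩ := Quotient.exact hxy
    exact h o x y w e hw
  have hadj : ∀ {s t}, Tr.Adj s t → Y.dist s.out t.out ≤ 2 * Δ + 1 := by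
    rintro s t ⟨-, x, y, hxy, hx, hy⟩
    have h1 : Y.dist s.out x ≤ Δ := hclass (by rw [Quotient.out_eq, hx])
    have h2 : Y.dist y t.out ≤ Δ := hclass (by rw [Quotient.out_eq, hy])
    have h3 := hconn.dist_triangle (u := s.out) (v := x) (w := t.out)
    have h4 := hconn.dist_triangle (u := x) (v := y) (w := t.out)
    rw [SimpleGraph.dist_eq_one_iff_adj.2 hxy] at h4
    omega
  have hwalk : ∀ {s t} (w : Tr.Walk s t), Y.dist s.out t.out ≤ (2 * Δ + 1) * w.length := by
    intro s t w
    induction w with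
    | nil => simp
    | @cons a b c hab w ih =>
      have h1 := hconn.dist_triangle (u := a.out) (v := b.out) (w := c.out)
      have h2 := hadj hab
      rw [SimpleGraph.Walk.length_cons, mul_add]
      omega
  refine ⟨Quotient S, Tr, ?_, hpre, Quotient.out, 2 * Δ + 1, Δ, by positivity, by positivity,
    fun s t => ⟨?_, ?_⟩, fun b => ⟨Quotient.mk S b, ?_⟩⟩
  · intro v c hc
    obtain ⟨u, hu, hmax⟩ := c.support.toFinset.exists_max_image ht ⟨v, by simp⟩
    rw [List.mem_toFinset] at hu
    have hmax' : ∀ z ∈ (c.rotate u hu).support, ht z ≤ ht u := fun z hz =>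
      hmax z (by simpa using hz)
    have hc' := hc.rotate hu
    have hnil := hc'.not_nil
    refine hc'.snd_ne_penultimate (huniq ((c.rotate u hu).adj_snd hnil)
      ((c.rotate u hu).adj_penultimate hnil).symm (hmax' _ ?_) (hmax' _ ?_))
    · exact SimpleGraph.Walk.getVert_mem_support _ _
    · exact SimpleGraph.Walk.getVert_mem_support _ _
  · obtain ⟨w, hw⟩ := (hY s.out t.out).exists_walk_length_eq_dist
    have h1 := hlip w
    rw [Quotient.out_eq, Quotient.out_eq, hw] at h1
    have h2 : (Tr.dist s t : ℝ) ≤ Y.dist s.out t.out := by exact_mod_cast h1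
    have h3 : (Tr.dist s t : ℝ) / (2 * Δ + 1) ≤ Tr.dist s t :=
      div_le_self (by positivity) (by linarith [(Nat.cast_nonneg Δ : (0 : ℝ) ≤ Δ)])
    linarith [(Nat.cast_nonneg Δ : (0 : ℝ) ≤ Δ)]
  · obtain ⟨w, hw⟩ := (hpre s t).exists_walk_length_eq_dist
    have h1 := hwalk w
    rw [hw] at h1
    have h2 : (Y.dist s.out t.out : ℝ) ≤ (2 * Δ + 1) * Tr.dist s t := by exact_mod_cast h1
    linarith [(Nat.cast_nonneg Δ : (0 : ℝ) ≤ Δ)]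
  · exact Nat.cast_le.2 (hclass (Quotient.out_eq _))

/-- A discrete intermediate value theorem, giving the first index at which a level is reached. -/
theorem exists_first_eq_of_step {f : ℕ → ℕ} {m i₀ N : ℕ} (hi₀ : i₀ ≤ N) (h0 : f i₀ ≤ m)
    (hN : m ≤ f N) (hs : ∀ i, i₀ ≤ i → i < N → f (i + 1) ≤ f i + 1) :
    ∃ i, i₀ ≤ i ∧ i ≤ N ∧ f i = m ∧ ∀ j, i₀ ≤ j → j < i → f j < m := by
  classical
  have hex : ∃ i, i₀ ≤ i ∧ m ≤ f i := ⟨N, hi₀, hN⟩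
  have hfind := Nat.find_spec hex
  have hmin : ∀ j, i₀ ≤ j → j < Nat.find hex → f j < m := fun j h1 h2 => by
    have := Nat.find_min hex h2
    by_contra! h3
    exact this ⟨h1, h3⟩
  have hle : Nat.find hex ≤ N := Nat.find_min' hex ⟨hi₀, hN⟩
  refine ⟨Nat.find hex, hfind.1, hle, ?_, hmin⟩
  rcases hfind.1.eq_or_lt with heq | hlt
  · rw [← heq] at hfind ⊢
    exact le_antisymm h0 hfind.2
  · have h1 := hmin (Nat.find hex - 1) (by omega) (by omega)
    have h2 := hs (Nat.find hex - 1) (by omega) (by omega)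
    rw [Nat.sub_add_cancel (by omega)] at h2
    omega

variable {ι : Type*} {Γ : SimpleGraph ι} {Gv : ι → Type*} [∀ v, Group (Gv v)]
  [∀ v, Nontrivial (Gv v)]

theorem cdist_le_of_sep {A B J : Hyperplane (gpCayley Γ Gv)} {p p' : GraphProduct Γ Gv}
    (hp : p ∈ nbh A) (hp' : p' ∈ nbh B) (h : Sep J p p') :
    cdist A J + cdist J B ≤ cdist A B + 2 := by
  obtain ⟨K, hJK, hK⟩ := exists_contact_of_sep hp hp' h
  have h1 := hJK.cdist_le
  have h2 := cdist_triangle A K J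
  have h3 := cdist_triangle J K B
  rw [cdist_comm K J] at h2
  omega

theorem isQuasiTreeGraph_contactGraph : IsQuasiTreeGraph (contactGraph (gpCayley Γ Gv)) := by
  refine isQuasiTreeGraph_of_bottleneck _ contactGraph_preconnected 8 fun A H K w he hw => ?_
  change cdist A H = cdist A K at he
  change ∀ Z ∈ w.support, cdist A H ≤ cdist A Z at hw
  change cdist H K ≤ 8
  by_cases hn : cdist A H ≤ 4
  · have := cdist_triangle H A K
    rw [cdist_comm H A] at this
    omega
  push Not at hn
  have hA := rep_mem_nbh A
  have hH := rep_mem_nbh H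
  have hK := rep_mem_nbh K
  obtain ⟨P⟩ := exists_geodPath A (rep A) (rep H)
  have hPn : P.n ≠ 0 := by
    intro h0
    have : rep A = rep H := by rw [← P.q_n, h0, P.q_zero]
    have := Contact.cdist_le ⟨rep A, hA, by rw [this]; exact hH⟩
    omega
  have h0 : cdist A (P.E 0) ≤ 1 :=
    Contact.cdist_le ⟨rep A, hA, by have := P.mem 0 (by omega); rwa [P.q_zero] at this⟩
  have hl : cdist (P.E (P.n - 1)) H ≤ 1 := by
    refine Contact.cdist_le ⟨rep H, ?_, hH⟩
    have := P.mem_succ (i := P.n - 1) (by omega)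
    rwa [Nat.sub_add_cancel (by omega), P.q_n] at this
  have hl' := cdist_triangle A (P.E (P.n - 1)) H
  obtain ⟨i, -, hi, hJ, -⟩ := exists_first_eq_of_step (f := fun i => cdist A (P.E i))
    (m := cdist A H - 2) (Nat.zero_le (P.n - 1)) (by omega) (by omega) fun i _ hi => by
      have h1 := P.cdist_succ_le (i := i) (by omega)
      have h2 := cdist_triangle A (P.E i) (P.E (i + 1))
      omega
  have hsH : Sep (P.E i) (rep A) (rep H) := P.sep_ends.2 ⟨i, by omega, rfl⟩
  have hns : ¬ Sep (P.E i) (rep H) (rep K) := by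
    intro hs
    obtain ⟨Z, hZ, hc, -⟩ := exists_contact_of_walk w hH hK hs
    have h1 := hw Z hZ
    have h2 := hc.cdist_le
    have h3 := cdist_triangle A (P.E i) Z
    omega
  have hsK := (sep_congr_right hns _).1 hsH
  have h1 := cdist_le_of_sep hA hH hsH
  have h2 := cdist_le_of_sep hA hK hsK
  have h3 := cdist_triangle H (P.E i) K
  rw [cdist_comm H (P.E i)] at h3
  omega

end QuasiTree

section Corridors

variable {ι : Type*} {Γ : SimpleGraph ι} {Gv : ι → Type*} [∀ v, Group (Gv v)]
  [∀ v, Nontrivial (Gv v)]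

/-- Two hyperplanes `A` and `B`, a geodesic of the Cayley graph between their carriers, and a
bound `δ` on the displacement of the elements considered. -/
structure Corridor (Γ : SimpleGraph ι) (Gv : ι → Type*) [∀ v, Group (Gv v)]
    [∀ v, Nontrivial (Gv v)] where
  /-- The first end. -/
  A : Hyperplane (gpCayley Γ Gv)
  /-- The second end. -/
  B : Hyperplane (gpCayley Γ Gv)
  /-- The initial vertex. -/
  o : GraphProduct Γ Gv
  /-- The terminal vertex. -/
  z : GraphProduct Γ Gv
  ho : o ∈ nbh A
  hz : z ∈ nbh B
  /-- The geodesic. -/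
  P : GeodPath o z
  /-- The displacement bound. -/
  δ : ℕ

namespace Corridor

variable (C : Corridor Γ Gv)

/-- The element `f` moves both ends of the corridor by at most `δ`. -/
def Near (f : GraphProduct Γ Gv) : Prop := cdist C.A (tr f C.A) ≤ C.δ ∧ cdist C.B (tr f C.B) ≤ C.δ

/-- The hyperplane `H` crosses the corridor. -/
def M (H : Hyperplane (gpCayley Γ Gv)) : Prop := Sep H C.o C.z

/-- The hyperplane `H` is at distance at least `r` from both ends of the corridor. -/
def Deep (r : ℕ) (H : Hyperplane (gpCayley Γ Gv)) : Prop := r ≤ cdist C.A H ∧ r ≤ cdist C.B H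

/-- The hyperplane `H` separates the origin of the corridor from the carrier of `K`. -/
def Prec (H K : Hyperplane (gpCayley Γ Gv)) : Prop := ∀ q ∈ nbh K, Sep H C.o q

open Classical in
/-- The position at which a hyperplane crosses the corridor. -/
noncomputable def pos (H : Hyperplane (gpCayley Γ Gv)) : ℕ :=
  if h : ∃ k < C.P.n, H = C.P.E k then h.choose else 0

variable {C}

theorem Deep.mono {r r' : ℕ} {H : Hyperplane (gpCayley Γ Gv)} (h : C.Deep r H) (hr : r' ≤ r) :
    C.Deep r' H := ⟨hr.trans h.1, hr.trans h.2⟩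

theorem pos_spec {H : Hyperplane (gpCayley Γ Gv)} (h : C.M H) :
    C.pos H < C.P.n ∧ C.P.E (C.pos H) = H := by
  have h' := C.P.sep_ends.1 h
  rw [pos, dif_pos h']
  exact ⟨h'.choose_spec.1, h'.choose_spec.2.symm⟩

theorem M_E {k : ℕ} (hk : k < C.P.n) : C.M (C.P.E k) := C.P.sep_ends.2 ⟨k, hk, rfl⟩

theorem pos_E {k : ℕ} (hk : k < C.P.n) : C.pos (C.P.E k) = k :=
  C.P.inj _ (pos_spec (M_E hk)).1 _ hk (pos_spec (M_E hk)).2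

theorem eq_of_pos_eq {H K : Hyperplane (gpCayley Γ Gv)} (hH : C.M H) (hK : C.M K)
    (h : C.pos H = C.pos K) : H = K := by
  rw [← (pos_spec hH).2, ← (pos_spec hK).2, h]

theorem sep_q_iff {H : Hyperplane (gpCayley Γ Gv)} (hH : C.M H) {j : ℕ} (hj : j ≤ C.P.n) :
    Sep H C.o (C.P.q j) ↔ C.pos H < j := by
  have h := C.P.sep H 0 j (Nat.zero_le _) hj
  rw [C.P.q_zero] at h
  rw [h]
  constructor
  · rintro ⟨k, -, hk, rfl⟩
    rwa [pos_E (by omega)]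
  · exact fun h => ⟨C.pos H, Nat.zero_le _, h, (pos_spec hH).2.symm⟩

theorem q_pos_mem {H : Hyperplane (gpCayley Γ Gv)} (hH : C.M H) : C.P.q (C.pos H) ∈ nbh H := by
  have h := C.P.mem _ (pos_spec hH).1
  rwa [(pos_spec hH).2] at h

theorem Prec.pos_lt {H K : Hyperplane (gpCayley Γ Gv)} (h : C.Prec H K) (hH : C.M H)
    (hK : C.M K) : C.pos H < C.pos K :=
  (sep_q_iff hH (pos_spec hK).1.le).1 (h _ (q_pos_mem hK))

theorem Prec.irrefl {H : Hyperplane (gpCayley Γ Gv)} (h : C.Prec H H) (hH : C.M H) : False :=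
  (h.pos_lt hH hH).false

theorem prec_of_pos_lt {H K : Hyperplane (gpCayley Γ Gv)} (hH : C.M H) (hK : C.M K)
    (hadj : ¬ Γ.Adj (lbl H) (lbl K)) (h : C.pos H < C.pos K) : C.Prec H K := by
  intro q hq
  have h1 := (sep_q_iff hH (pos_spec hK).1.le).2 h
  have hne : H ≠ K := by rintro rfl; exact h.false
  exact (sep_congr_right (not_sep_of_mem_nbh hne (fun h => hadj h.symm) (q_pos_mem hK) hq) _).1 h1

theorem prec_trichotomy {H K : Hyperplane (gpCayley Γ Gv)} (hH : C.M H) (hK : C.M K)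
    (hadj : ¬ Γ.Adj (lbl H) (lbl K)) : H = K ∨ C.Prec H K ∨ C.Prec K H := by
  rcases lt_trichotomy (C.pos H) (C.pos K) with h | h | h
  · exact Or.inr (Or.inl (prec_of_pos_lt hH hK hadj h))
  · exact Or.inl (eq_of_pos_eq hH hK h)
  · exact Or.inr (Or.inr (prec_of_pos_lt hK hH (fun h => hadj h.symm) h))

theorem Prec.sep {K Y : Hyperplane (gpCayley Γ Gv)} (h : C.Prec K Y) {p : GraphProduct Γ Gv}
    (hp : Sep Y C.o p) : Sep K C.o p := by
  obtain ⟨P⟩ := exists_geodPath K C.o p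
  obtain ⟨i, hi, rfl⟩ := P.sep_ends.1 hp
  have h1 := h _ (P.mem i hi)
  have h2 := P.sep K 0 i (Nat.zero_le _) hi.le
  rw [P.q_zero] at h2
  obtain ⟨k, -, hk, rfl⟩ := h2.1 h1
  exact P.sep_ends.2 ⟨k, by omega, rfl⟩

theorem Prec.trans {H K L : Hyperplane (gpCayley Γ Gv)} (h : C.Prec H K) (h' : C.Prec K L) :
    C.Prec H L := fun q hq => h.sep (h' q hq)

theorem cdist_add_le {H K : Hyperplane (gpCayley Γ Gv)} (hH : C.M H) (hK : C.M K)
    (h : C.pos H ≤ C.pos K) :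
    cdist C.A H ≤ cdist C.A K + 2 ∧ cdist C.B K ≤ cdist C.B H + 2 := by
  rcases h.eq_or_lt with h | h
  · rw [eq_of_pos_eq hH hK h]; omega
  have h1 := cdist_le_of_sep C.ho (q_pos_mem hK) ((sep_q_iff hH (pos_spec hK).1.le).2 h)
  have h2 : Sep K C.z (C.P.q (C.pos H)) := by
    have := (C.P.sep K (C.pos H) C.P.n (pos_spec hH).1.le le_rfl).2
      ⟨C.pos K, h.le, (pos_spec hK).1, (pos_spec hK).2.symm⟩
    rw [C.P.q_n] at this
    exact this.symm
  have h3 := cdist_le_of_sep C.hz (q_pos_mem hH) h2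
  omega

/-- A hyperplane crossing the corridor between two deep ones is deep. -/
theorem Deep.between {H K L : Hyperplane (gpCayley Γ Gv)} {r : ℕ} (hH : C.M H) (hK : C.M K)
    (hL : C.M L) (dH : C.Deep (r + 2) H) (dL : C.Deep (r + 2) L) (h1 : C.pos H ≤ C.pos K)
    (h2 : C.pos K ≤ C.pos L) : C.Deep r K := by
  have e1 := cdist_add_le hH hK h1
  have e2 := cdist_add_le hK hL h2
  have := dH.1
  have := dL.2
  exact ⟨by omega, by omega⟩

theorem Near.inv {f : GraphProduct Γ Gv} (hf : C.Near f) : C.Near f⁻¹ := by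
  have key : ∀ H : Hyperplane (gpCayley Γ Gv), cdist H (tr f⁻¹ H) = cdist H (tr f H) := fun H => by
    rw [← cdist_tr f H (tr f⁻¹ H), tr_tr_inv, cdist_comm]
  exact ⟨(key _).trans_le hf.1, (key _).trans_le hf.2⟩

theorem Deep.tr {f : GraphProduct Γ Gv} (hf : C.Near f) {r : ℕ} {H : Hyperplane (gpCayley Γ Gv)}
    (h : C.Deep (r + C.δ) H) : C.Deep r (tr f H) := by
  have key : ∀ A : Hyperplane (gpCayley Γ Gv),
      cdist A H ≤ cdist A (QM.tr f A) + cdist A (QM.tr f H) :=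
    fun A => by
      rw [← cdist_tr f A H, cdist_comm A (QM.tr f A)]
      exact cdist_triangle _ _ _
  have h1 := key C.A
  have h2 := key C.B
  have h3 := hf.1
  have h4 := hf.2
  have h5 := h.1
  have h6 := h.2
  exact ⟨by omega, by omega⟩

theorem not_sep_mul {f : GraphProduct Γ Gv} (hf : C.Near f) {H : Hyperplane (gpCayley Γ Gv)}
    (h : C.Deep (C.δ + 3) H) : ¬ Sep H C.o (C.o * f) ∧ ¬ Sep H C.z (C.z * f) := by
  constructor <;> intro hs
  · have h1 := cdist_le_of_sep C.ho (mem_nbh_tr.2 C.ho) hs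
    have h2 := hf.1
    have h3 := h.1
    omega
  · have h1 := cdist_le_of_sep C.hz (mem_nbh_tr.2 C.hz) hs
    have h2 := hf.2
    have h3 := h.2
    omega

theorem not_sep_tr {f : GraphProduct Γ Gv} (hf : C.Near f) {H : Hyperplane (gpCayley Γ Gv)}
    (h : C.Deep (C.δ + 3) H) :
    ¬ Sep (tr f H) C.o (C.o * f) ∧ ¬ Sep (tr f H) C.z (C.z * f) := by
  have key : ∀ x : GraphProduct Γ Gv, Sep (tr f H) x (x * f) ↔ Sep H x (x * f⁻¹) := fun x => by
    conv_lhs => rw [← inv_mul_cancel_right x f, sep_tr, inv_mul_cancel_right]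
    exact sep_comm
  rw [key, key]
  exact not_sep_mul hf.inv h

theorem M_tr {f : GraphProduct Γ Gv} (hf : C.Near f) {H : Hyperplane (gpCayley Γ Gv)}
    (h : C.Deep (C.δ + 3) H) (hH : C.M H) : C.M (tr f H) := by
  obtain ⟨h1, h2⟩ := not_sep_tr hf h
  rw [M, sep_congr_left h1, sep_congr_right h2, sep_tr]
  exact hH

theorem Prec.tr {f : GraphProduct Γ Gv} (hf : C.Near f) {H K : Hyperplane (gpCayley Γ Gv)}
    (h : C.Deep (C.δ + 3) H) (hHK : C.Prec H K) : C.Prec (tr f H) (tr f K) := by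
  intro q hq
  rw [← inv_mul_cancel_right q f, mem_nbh_tr] at hq
  rw [sep_congr_left (not_sep_tr hf h).1, ← inv_mul_cancel_right q f, sep_tr]
  exact hHK _ hq

/-- An element cannot push two hyperplanes crossing the corridor towards each other. -/
theorem false_of_squeeze {f : GraphProduct Γ Gv} (hf : C.Near f) {H K : Hyperplane (gpCayley Γ Gv)}
    (hH : C.M H) (hK : C.M K)
    (deep : ∀ L, C.M L → C.pos H ≤ C.pos L → C.pos L ≤ C.pos K → C.Deep (C.δ + 3) L)
    (hHK : C.Prec H K) (h1 : H = tr f H ∨ C.Prec H (tr f H)) (h2 : tr f K = K ∨ C.Prec (tr f K) K)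
    (h : C.Prec H (tr f H) ∨ C.Prec (tr f K) K) : False := by
  obtain ⟨d, hd⟩ : ∃ d, d = C.pos K - C.pos H := ⟨_, rfl⟩
  induction d using Nat.strong_induction_on generalizing H K with
  | _ d ih =>
    have hlt := hHK.pos_lt hH hK
    have dH := deep H hH le_rfl hlt.le
    have dK := deep K hK hlt.le le_rfl
    have hH' := M_tr hf dH hH
    have hK' := M_tr hf dK hK
    have hHK' := hHK.tr hf dH
    have hlt' := hHK'.pos_lt hH' hK'
    have e1 : C.pos H ≤ C.pos (QM.tr f H) := by
      rcases h1 with h1 | h1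
      · rw [← h1]
      · exact (h1.pos_lt hH hH').le
    have e2 : C.pos (QM.tr f K) ≤ C.pos K := by
      rcases h2 with h2 | h2
      · rw [h2]
      · exact (h2.pos_lt hK' hK).le
    have e3 : C.pos H < C.pos (QM.tr f H) ∨ C.pos (QM.tr f K) < C.pos K :=
      h.imp (fun h => h.pos_lt hH hH') (fun h => h.pos_lt hK' hK)
    have dK' := deep _ hK' (by omega) (by omega)
    refine ih (C.pos (QM.tr f K) - C.pos (QM.tr f H)) (by omega) hH' hK'
      (fun L hL l1 l2 => deep L hL (by omega) (by omega)) hHK'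
      (h1.imp (congrArg _) fun h => h.tr hf dH) (h2.imp (congrArg _) fun h => h.tr hf dK')
      (h.imp (fun h => h.tr hf dH) fun h => h.tr hf dK') rfl

/-- Hyperplanes with non-adjacent labels are moved in the same direction. -/
theorem prec_tr_of_prec_tr {f : GraphProduct Γ Gv} (hf : C.Near f)
    {H K : Hyperplane (gpCayley Γ Gv)} (hH : C.M H) (hK : C.M K) (dH : C.Deep (2 * C.δ + 5) H)
    (dK : C.Deep (2 * C.δ + 5) K) (hadj : ¬ Γ.Adj (lbl H) (lbl K)) (h : C.Prec H (tr f H)) :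
    C.Prec K (tr f K) := by
  have dH' : C.Deep (C.δ + 3) H := dH.mono (by omega)
  have dK' : C.Deep (C.δ + 3) K := dK.mono (by omega)
  have dKf : C.Deep (C.δ + 3) (QM.tr f K) := Deep.tr hf (dK.mono (by omega))
  have hKf := M_tr hf dK' hK
  by_contra hn
  have h2 : QM.tr f K = K ∨ C.Prec (QM.tr f K) K := by
    rcases prec_trichotomy hK hKf (by rw [lbl_tr]; exact Γ.loopless.irrefl _) with e | e | e
    · exact Or.inl e.symm
    · exact absurd e hn
    · exact Or.inr e
  rcases prec_trichotomy hH hK hadj with rfl | e | e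
  · exact hn h
  · exact false_of_squeeze hf hH hK (fun L hL l1 l2 => Deep.between hH hL hK (dH.mono (by omega))
      (dK.mono (by omega)) l1 l2) e (Or.inr h) h2 (Or.inl h)
  · have h3 : C.Prec (QM.tr f⁻¹ H) H := by
      have := h.tr hf.inv dH'
      rwa [tr_inv_tr] at this
    refine false_of_squeeze hf.inv hK hH (fun L hL l1 l2 => Deep.between hK hL hH
      (dK.mono (by omega)) (dH.mono (by omega)) l1 l2) e ?_ (Or.inr h3) (Or.inr h3)
    refine h2.imp (fun h => ?_) (fun h => ?_)
    · conv_lhs => rw [← tr_inv_tr f K, h]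
    · have := h.tr hf.inv dKf
      rwa [tr_inv_tr] at this

end Corridor

end Corridors

section Windows

variable {ι : Type*} {Γ : SimpleGraph ι} {Gv : ι → Type*} [∀ v, Group (Gv v)]
  [∀ v, Nontrivial (Gv v)]

namespace Corridor

/-- A short stretch of the geodesic of a corridor, deep inside the corridor. -/
structure Window (C : Corridor Γ Gv) where
  /-- The first index. -/
  i₁ : ℕ
  /-- The last index. -/
  i₂ : ℕ
  lt : i₁ < i₂
  lt_n : i₂ < C.P.n
  cdist_A : cdist C.A (C.P.E i₁) = 3 * C.δ + 13
  le_cdist_B : 3 * C.δ + 13 ≤ cdist C.B (C.P.E i₁)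
  cdist_eq : cdist (C.P.E i₁) (C.P.E i₂) = 4
  le_cdist_pred : 3 ≤ cdist (C.P.E i₁) (C.P.E (i₂ - 1))
  cdist_le : ∀ k, i₁ ≤ k → k < i₂ → cdist (C.P.E i₁) (C.P.E k) ≤ 3

theorem exists_window (C : Corridor Γ Gv) (h : 6 * C.δ + 40 ≤ cdist C.A C.B) :
    Nonempty C.Window := by
  have hn : 0 < C.P.n := by
    by_contra hn
    have h0 : C.P.n = 0 := by omega
    have h1 : C.o = C.z := C.P.q_zero.symm.trans (h0 ▸ C.P.q_n)
    have h2 : cdist C.A C.B ≤ 1 := Contact.cdist_le ⟨C.o, C.ho, h1 ▸ C.hz⟩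
    omega
  have hfirst : cdist C.A (C.P.E 0) ≤ 1 :=
    Contact.cdist_le ⟨C.o, C.ho, by have := C.P.mem 0 hn; rwa [C.P.q_zero] at this⟩
  have hlast : cdist (C.P.E (C.P.n - 1)) C.B ≤ 1 :=
    Contact.cdist_le ⟨C.z, by
      have := C.P.mem_succ (i := C.P.n - 1) (by omega)
      rwa [Nat.sub_add_cancel hn, C.P.q_n] at this, C.hz⟩
  have step : ∀ H i, i < C.P.n - 1 → cdist H (C.P.E (i + 1)) ≤ cdist H (C.P.E i) + 1 :=
    fun H i hi => (cdist_triangle H (C.P.E i) _).trans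
      (Nat.add_le_add_left (C.P.cdist_succ_le (by omega)) _)
  have t1 := cdist_triangle C.A (C.P.E (C.P.n - 1)) C.B
  obtain ⟨i₁, -, hi₁, e₁, -⟩ := exists_first_eq_of_step (f := fun i => cdist C.A (C.P.E i))
    (m := 3 * C.δ + 13) (Nat.zero_le (C.P.n - 1)) (by omega) (by omega)
    (fun i _ hi => step _ i hi)
  have t2 := cdist_triangle C.A (C.P.E i₁) (C.P.E (C.P.n - 1))
  have t3 := cdist_triangle C.A (C.P.E i₁) C.B
  have t4 : cdist (C.P.E i₁) (C.P.E i₁) = 0 := SimpleGraph.dist_self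
  obtain ⟨i₂, h12, hi₂, e₂, hlt⟩ := exists_first_eq_of_step
    (f := fun i => cdist (C.P.E i₁) (C.P.E i)) (m := 4) hi₁ (by omega)
    (by omega) (fun i _ hi => step _ i hi)
  have hne : i₁ ≠ i₂ := by rintro rfl; omega
  have hs := step (C.P.E i₁) (i₂ - 1) (by omega)
  rw [Nat.sub_add_cancel (by omega)] at hs
  refine ⟨⟨i₁, i₂, by omega, by omega, e₁, ?_, e₂, by omega, fun k h1 h2 => ?_⟩⟩
  · rw [cdist_comm]; omega
  · have := hlt k h1 h2; omega

namespace Window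

variable {C : Corridor Γ Gv} (I : C.Window)

/-- The first hyperplane of a window. -/
def U : Hyperplane (gpCayley Γ Gv) := C.P.E I.i₁

open Classical in
/-- The labels of the hyperplanes of a window. -/
noncomputable def W : Finset ι := (Finset.Ico I.i₁ I.i₂).image fun k => lbl (C.P.E k)

variable {I}

theorem mem_W {w : ι} : w ∈ I.W ↔ ∃ k, (I.i₁ ≤ k ∧ k < I.i₂) ∧ lbl (C.P.E k) = w := by
  simp [W]

theorem lbl_U_mem : lbl I.U ∈ I.W := mem_W.2 ⟨I.i₁, ⟨le_rfl, I.lt⟩, rfl⟩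

theorem M_E {k : ℕ} (h : I.i₁ ≤ k ∧ k < I.i₂) : C.M (C.P.E k) :=
  Corridor.M_E (h.2.trans I.lt_n)

theorem deep_E {k : ℕ} (h : I.i₁ ≤ k ∧ k < I.i₂) : C.Deep (3 * C.δ + 9) (C.P.E k) := by
  have h1 := I.cdist_le k h.1 h.2
  have h2 := cdist_triangle C.A (C.P.E k) (C.P.E I.i₁)
  have h3 := cdist_triangle C.B (C.P.E k) (C.P.E I.i₁)
  rw [cdist_comm (C.P.E k)] at h2 h3
  have := I.cdist_A
  have := I.le_cdist_B
  exact ⟨by omega, by omega⟩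

/-- No hyperplane is in contact with both ends of a window. -/
theorem not_contact {J : Hyperplane (gpCayley Γ Gv)} {p : GraphProduct Γ Gv} (hp : p ∈ nbh J)
    (hpU : p ∈ nbh I.U) (h : C.P.q I.i₂ ∈ nbh J) : False := by
  have h1 : cdist I.U J ≤ 1 := Contact.cdist_le ⟨p, hpU, hp⟩
  have h2 : cdist J (C.P.E I.i₂) ≤ 1 := Contact.cdist_le ⟨_, h, C.P.mem _ I.lt_n⟩
  have h3 := cdist_triangle I.U J (C.P.E I.i₂)
  have h4 : cdist I.U (C.P.E I.i₂) = 4 := I.cdist_eq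
  omega

theorem q_mem_U : C.P.q I.i₁ ∈ nbh I.U := C.P.mem _ (I.lt.trans I.lt_n)

theorem exists_not_mem_star (c : ι) : ∃ w ∈ I.W, ¬ (w = c ∨ Γ.Adj c w) := by
  by_contra! h
  refine I.not_contact (mem_nbh_self c (C.P.q I.i₁)) q_mem_U ?_
  have key : ∀ j, I.i₁ ≤ j → j ≤ I.i₂ → C.P.q j ∈ nbh (hyp c (C.P.q I.i₁)) := by
    intro j hj
    induction j, hj using Nat.le_induction with
    | base => exact fun _ => mem_nbh_self _ _
    | succ j hj ih =>
      intro hj'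
      obtain ⟨s, hs⟩ := C.P.step j (by have := I.lt_n; omega)
      rw [hs]
      refine gpOf_mul_mem_nbh (ih (by omega)) ?_ s
      rw [lbl_hyp]
      exact h _ (mem_W.2 ⟨j, ⟨hj, by omega⟩, rfl⟩)
  exact key _ I.lt.le le_rfl

theorem not_join {S T : Set ι} (hW : ∀ w ∈ I.W, w ∈ S ∨ w ∈ T) (hU : lbl I.U ∈ S)
    (hT : T.Nonempty) : ∃ s ∈ S, ∃ t ∈ T, ¬ Γ.Adj s t := by
  by_contra! hadj
  obtain ⟨t, ht⟩ := hT
  have key : ∀ j, I.i₁ ≤ j → j ≤ I.i₂ → ∃ x y, C.P.q j = y * (x * C.P.q I.i₁) ∧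
      x ∈ gpStar Γ Gv (lbl I.U) ∧ y ∈ gpStar Γ Gv t ∧
      ∀ t ∈ T, ∀ r : Gv t, gpOf Γ Gv t r * y = y * gpOf Γ Gv t r := by
    intro j hj
    induction j, hj using Nat.le_induction with
    | base => exact fun _ => ⟨1, 1, by simp, one_mem _, one_mem _, by simp⟩
    | succ j hj ih =>
      intro hj'
      obtain ⟨x, y, e, hx, hy, hc⟩ := ih (by omega)
      obtain ⟨s, hs⟩ := C.P.step j (by have := I.lt_n; omega)
      generalize hw : lbl (C.P.E j) = w at s hs
      rw [hs, e]
      rcases hW w (mem_W.2 ⟨j, ⟨hj, by omega⟩, hw⟩) with h | h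
      · refine ⟨x, gpOf Γ Gv w s * y, by group, hx,
          mul_mem (gpOf_mem_gpStar (Or.inr (hadj _ h _ ht).symm) s) hy, fun t' ht' r => ?_⟩
        rw [← mul_assoc, ← gpOf_comm (hadj _ h _ ht') s r, mul_assoc, hc t' ht' r, mul_assoc]
      · refine ⟨gpOf Γ Gv w s * x, y, ?_,
          mul_mem (gpOf_mem_gpStar (Or.inr (hadj _ hU _ h)) s) hx, hy, hc⟩
        rw [← mul_assoc, hc w h s]
        group
  obtain ⟨x, y, e, hx, hy, -⟩ := key _ I.lt.le le_rfl
  refine I.not_contact (mem_nbh_self t (x * C.P.q I.i₁)) ?_ ?_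
  · exact mem_nbh_of_mul_inv_mem q_mem_U (by rwa [mul_inv_cancel_right])
  · rw [e, mem_nbh_hyp, mul_inv_cancel_right]
    exact hy

/-- The complement of the subgraph induced by the labels of a window is connected. -/
theorem exists_not_adj {S : Set ι} (h1 : ∃ w ∈ I.W, w ∈ S) (h2 : ∃ w ∈ I.W, w ∉ S) :
    ∃ s ∈ I.W, s ∈ S ∧ ∃ t ∈ I.W, t ∉ S ∧ ¬ Γ.Adj s t := by
  by_cases hU : lbl I.U ∈ S
  · obtain ⟨s, hs, t, ht, h⟩ := I.not_join (S := {w | w ∈ I.W ∧ w ∈ S})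
      (T := {w | w ∈ I.W ∧ w ∉ S}) (fun w hw => by simp [hw, em]) ⟨lbl_U_mem, hU⟩ h2
    exact ⟨s, hs.1, hs.2, t, ht.1, ht.2, h⟩
  · obtain ⟨s, hs, t, ht, h⟩ := I.not_join (S := {w | w ∈ I.W ∧ w ∉ S})
      (T := {w | w ∈ I.W ∧ w ∈ S}) (fun w hw => by simp [hw, em']) ⟨lbl_U_mem, hU⟩ h1
    exact ⟨t, ht.1, ht.2, s, hs.1, hs.2, fun h' => h h'.symm⟩

theorem label_induction {p : ι → Prop} {v : ι} (hv : v ∈ I.W) (h0 : p v)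
    (step : ∀ s ∈ I.W, p s → ∀ t ∈ I.W, ¬ Γ.Adj s t → p t) : ∀ w ∈ I.W, p w := by
  by_contra! hn
  obtain ⟨s, hs, hps, t, ht, hpt, h⟩ := I.exists_not_adj (S := {w | p w}) ⟨v, hv, h0⟩ hn
  exact hpt (step s hs hps t ht h)

/-- All deep hyperplanes with labels in a window are moved in the same direction. -/
theorem prec_tr {f : GraphProduct Γ Gv} (hf : C.Near f) {H K : Hyperplane (gpCayley Γ Gv)}
    (hH : C.M H) (dH : C.Deep (2 * C.δ + 5) H) (lH : lbl H ∈ I.W) (h : C.Prec H (tr f H))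
    (hK : C.M K) (dK : C.Deep (2 * C.δ + 5) K) (lK : lbl K ∈ I.W) : C.Prec K (tr f K) := by
  refine I.label_induction (p := fun w => ∀ K, C.M K → C.Deep (2 * C.δ + 5) K → lbl K = w →
    C.Prec K (tr f K)) lH ?_ ?_ _ lK K hK dK rfl
  · exact fun K hK dK lK => prec_tr_of_prec_tr hf hH hK dH dK
      (lK ▸ Γ.loopless.irrefl _) h
  · rintro s hs ih t - hst K hK dK rfl
    obtain ⟨k, hk, rfl⟩ := mem_W.1 hs
    have dk : C.Deep (2 * C.δ + 5) (C.P.E k) := (deep_E hk).mono (by omega)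
    exact prec_tr_of_prec_tr hf (M_E hk) hK dk dK hst (ih _ (M_E hk) dk rfl)

theorem tr_eq {f : GraphProduct Γ Gv} (hf : C.Near f) {H K : Hyperplane (gpCayley Γ Gv)}
    (hH : C.M H) (dH : C.Deep (2 * C.δ + 5) H) (lH : lbl H ∈ I.W) (h : tr f H = H)
    (hK : C.M K) (dK : C.Deep (3 * C.δ + 5) K) (lK : lbl K ∈ I.W) : tr f K = K := by
  have hK' := M_tr hf (dK.mono (by omega)) hK
  rcases prec_trichotomy hK hK' (by rw [lbl_tr]; exact Γ.loopless.irrefl _) with e | e | e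
  · exact e.symm
  · have := I.prec_tr hf hK (dK.mono (by omega)) lK e hH dH lH
    rw [h] at this
    exact (this.irrefl hH).elim
  · have dK' : C.Deep (2 * C.δ + 5) (tr f K) := Deep.tr hf (dK.mono (by omega))
    have := I.prec_tr hf.inv hK' dK' (by rwa [lbl_tr]) (by rwa [tr_inv_tr]) hH dH lH
    rw [← h, tr_inv_tr, h] at this
    exact (this.irrefl hH).elim

theorem eq_one_of_tr_U_eq {f : GraphProduct Γ Gv} (hf : C.Near f) (h : tr f I.U = I.U) :
    f = 1 := by
  have fixed : ∀ k, I.i₁ ≤ k ∧ k < I.i₂ → tr f (C.P.E k) = C.P.E k := fun k hk =>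
    I.tr_eq hf (M_E ⟨le_rfl, I.lt⟩) ((deep_E ⟨le_rfl, I.lt⟩).mono (by omega)) lbl_U_mem h
      (M_E hk) ((deep_E hk).mono (by omega)) (mem_W.2 ⟨k, hk, rfl⟩)
  have hlt := I.lt
  have hn := I.lt_n
  have mem : ∀ k, I.i₁ ≤ k ∧ k < I.i₂ → C.P.q k * f ∈ nbh (C.P.E k) := fun k hk => by
    rw [← fixed k hk, mem_nbh_tr]
    exact C.P.mem k (by omega)
  have key : C.P.q I.i₁ = C.P.q I.i₁ * f := by
    refine eq_of_forall_not_sep I.U fun H hs => ?_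
    have h1 : cdist (C.P.E I.i₁) H ≤ 1 :=
      (contact_of_sep (C.P.mem _ (by omega)) (mem _ ⟨le_rfl, hlt⟩) hs).1.symm.cdist_le
    have h2 : ¬ Sep H (C.P.q (I.i₂ - 1)) (C.P.q (I.i₂ - 1) * f) := fun hs' => by
      have h2 := (contact_of_sep (C.P.mem _ (by omega)) (mem (I.i₂ - 1) (by omega)) hs').1.cdist_le
      have h3 := cdist_triangle (C.P.E I.i₁) H (C.P.E (I.i₂ - 1))
      have h4 := I.le_cdist_pred
      omega
    suffices h3 : ∃ k, (I.i₁ ≤ k ∧ k < I.i₂) ∧ H = C.P.E k by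
      obtain ⟨k, hk, rfl⟩ := h3
      exact h2 ((sep_mul_of_tr_eq (fixed k hk) _ _).1 hs)
    rcases hs.or (C.P.q (I.i₂ - 1)) with hs | hs
    · obtain ⟨k, hk, hk', rfl⟩ := (C.P.sep H _ _ (by omega) (by omega)).1 hs
      exact ⟨k, ⟨hk, by omega⟩, rfl⟩
    · have hs' := ((hs.or (C.P.q (I.i₂ - 1) * f)).resolve_left h2).symm
      rw [← tr_tr_inv f H, sep_tr] at hs'
      obtain ⟨k, hk, hk', e⟩ := (C.P.sep _ _ _ (by omega) (by omega)).1 hs'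
      refine ⟨k, ⟨hk, by omega⟩, ?_⟩
      rw [← fixed k ⟨hk, by omega⟩, ← e, tr_tr_inv]
  exact (mul_eq_left.1 key.symm)

/-- Between a hyperplane and its image there is a hyperplane of every non-adjacent label. -/
theorem exists_between {f : GraphProduct Γ Gv} (hf : C.Near f)
    (fwd : ∀ K, C.M K → C.Deep (2 * C.δ + 5) K → lbl K ∈ I.W → C.Prec K (tr f K))
    {Y : Hyperplane (gpCayley Γ Gv)} (hY : C.M Y) (dY : C.Deep (2 * C.δ + 7) Y) (lY : lbl Y ∈ I.W)
    {w : ι} (hw : w ∈ I.W) (hne : lbl Y ≠ w) (hadj : ¬ Γ.Adj (lbl Y) w) :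
    ∃ Y', C.M Y' ∧ lbl Y' = w ∧ C.Prec Y Y' ∧ C.Prec Y' (tr f Y) := by
  have dY₅ : C.Deep (2 * C.δ + 5) Y := dY.mono (by omega)
  have dY₃ : C.Deep (C.δ + 3) Y := dY.mono (by omega)
  have hfY := M_tr hf dY₃ hY
  have before : ∀ d E, d = C.pos Y - C.pos E → C.M E → lbl E = w → C.Prec E Y →
      (∀ L, C.M L → C.pos E ≤ C.pos L → C.pos L ≤ C.pos Y → C.Deep (2 * C.δ + 5) L) →
      ∃ Y', C.M Y' ∧ lbl Y' = w ∧ C.Prec Y Y' ∧ C.Prec Y' (tr f Y) := by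
    intro d
    induction d using Nat.strong_induction_on with
    | _ d ih =>
      intro E hd hE lE hEY deep
      have hlt := hEY.pos_lt hE hY
      have dE := deep E hE le_rfl hlt.le
      have dE₃ : C.Deep (C.δ + 3) E := dE.mono (by omega)
      have hfE := M_tr hf dE₃ hE
      have hEf := fwd E hE dE (lE ▸ hw)
      have hlt' := hEf.pos_lt hE hfE
      have lfE : lbl (tr f E) = w := by rw [lbl_tr, lE]
      rcases prec_trichotomy hY hfE (by rwa [lfE]) with e | e | e
      · exact absurd (e ▸ lfE) hne
      · exact ⟨_, hfE, lfE, e, hEY.tr hf dE₃⟩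
      · have hlt'' := e.pos_lt hfE hY
        exact ih _ (by omega) _ rfl hfE lfE e fun L hL h1 h2 => deep L hL (by omega) h2
  have after : ∀ d E, d = C.pos E - C.pos Y → C.M E → lbl E = w → C.Prec Y E →
      (∀ L, C.M L → C.pos Y ≤ C.pos L → C.pos L ≤ C.pos E → C.Deep (2 * C.δ + 5) L) →
      ∃ Y', C.M Y' ∧ lbl Y' = w ∧ C.Prec Y Y' ∧ C.Prec Y' (tr f Y) := by
    intro d
    induction d using Nat.strong_induction_on with
    | _ d ih =>
      intro E hd hE lE hYE deep
      have hlt := hYE.pos_lt hY hE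
      have dE := deep E hE hlt.le le_rfl
      have dE₃ : C.Deep (C.δ + 3) E := dE.mono (by omega)
      have hYf := (fwd Y hY dY₅ lY).pos_lt hY hfY
      rcases prec_trichotomy hE hfY (by rw [lE, lbl_tr]; exact fun h => hadj h.symm) with e | e | e
      · rw [e, lbl_tr] at lE
        exact absurd lE hne
      · exact ⟨E, hE, lE, hYE, e⟩
      · have hlt' := e.pos_lt hfY hE
        have e' := e.tr hf.inv ((deep _ hfY hYf.le hlt'.le).mono (by omega))
        rw [tr_inv_tr] at e'
        have hE' := M_tr hf.inv dE₃ hE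
        have hEE := (fwd E hE dE (lE ▸ hw)).tr hf.inv dE₃
        rw [tr_inv_tr] at hEE
        have hlt₁ := e'.pos_lt hY hE'
        have hlt₂ := hEE.pos_lt hE' hE
        exact ih _ (by omega) _ rfl hE' (by rw [lbl_tr, lE]) e'
          fun L hL h1 h2 => deep L hL h1 (by omega)
  obtain ⟨k, hk, lE⟩ := mem_W.1 hw
  have hE := M_E hk
  have dE : C.Deep (2 * C.δ + 5 + 2) (C.P.E k) := (deep_E hk).mono (by omega)
  rcases prec_trichotomy hY hE (by rwa [lE]) with e | e | e
  · exact absurd (e ▸ lE) hne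
  · exact after _ _ rfl hE lE e fun L hL h1 h2 => Deep.between hY hL hE dY dE h1 h2
  · exact before _ _ rfl hE lE e fun L hL h1 h2 => Deep.between hE hL hY dE dY h1 h2

end Window

end Corridor

end Windows

section Counting

variable {ι : Type*} {Γ : SimpleGraph ι} {Gv : ι → Type*} [∀ v, Group (Gv v)]
  [∀ v, Nontrivial (Gv v)]

namespace Corridor

/-- The element `g` moves both ends of the corridor by at most `e`. -/
def Moves (C : Corridor Γ Gv) (e : ℕ) (g : GraphProduct Γ Gv) : Prop :=
  cdist C.A (tr g C.A) ≤ e ∧ cdist C.B (tr g C.B) ≤ e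

theorem cdist_tr_mul_le {g h : GraphProduct Γ Gv} {e e' : ℕ} {H : Hyperplane (gpCayley Γ Gv)}
    (hg : cdist H (tr g H) ≤ e) (hh : cdist H (tr h H) ≤ e') :
    cdist H (tr (g * h) H) ≤ e + e' := by
  have := cdist_triangle H (tr h H) (tr h (tr g H))
  rw [cdist_tr] at this
  rw [← tr_tr]
  omega

theorem cdist_tr_inv (g : GraphProduct Γ Gv) (H : Hyperplane (gpCayley Γ Gv)) :
    cdist H (tr g⁻¹ H) = cdist H (tr g H) := by
  rw [← cdist_tr g H (tr g⁻¹ H), tr_tr_inv, cdist_comm]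

theorem Moves.mul {C : Corridor Γ Gv} {e e' : ℕ} {g h : GraphProduct Γ Gv} (hg : C.Moves e g)
    (hh : C.Moves e' h) : C.Moves (e + e') (g * h) :=
  ⟨cdist_tr_mul_le hg.1 hh.1, cdist_tr_mul_le hg.2 hh.2⟩

theorem Moves.inv {C : Corridor Γ Gv} {e : ℕ} {g : GraphProduct Γ Gv} (hg : C.Moves e g) :
    C.Moves e g⁻¹ := ⟨(cdist_tr_inv _ _).trans_le hg.1, (cdist_tr_inv _ _).trans_le hg.2⟩

theorem Moves.near {C : Corridor Γ Gv} {e : ℕ} {g : GraphProduct Γ Gv} (hg : C.Moves e g)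
    (he : e ≤ C.δ) : C.Near g := ⟨hg.1.trans he, hg.2.trans he⟩

namespace Window

variable {C : Corridor Γ Gv} {I : C.Window}

theorem card_W_le {D : ℕ} (hD : ∀ v, (Γ.neighborSet v).Finite ∧ (Γ.neighborSet v).ncard ≤ D) :
    I.W.card ≤ 5 * (D + 1) := by
  classical
  have hlt := I.lt
  have hn := I.lt_n
  obtain ⟨w, hw⟩ := (contactGraph_preconnected I.U (C.P.E I.i₂)).exists_walk_length_eq_dist
  have hw' : w.length = 4 := hw.trans I.cdist_eq
  let star : Hyperplane (gpCayley Γ Gv) → Finset ι := fun K =>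
    insert (lbl K) (hD (lbl K)).1.toFinset
  have hsub : I.W ⊆ w.support.toFinset.biUnion star := by
    intro v hv
    obtain ⟨k, hk, rfl⟩ := mem_W.1 hv
    have hs := (C.P.sep (C.P.E k) I.i₁ I.i₂ hlt.le hn.le).2 ⟨k, hk.1, hk.2, rfl⟩
    obtain ⟨K, hK, -, h⟩ := exists_contact_of_walk w q_mem_U (C.P.mem _ hn) hs
    refine Finset.mem_biUnion.2 ⟨K, List.mem_toFinset.2 hK, ?_⟩
    simpa [star] using h
  have hstar : ∀ K ∈ w.support.toFinset, (star K).card ≤ D + 1 := fun K _ => by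
    refine (Finset.card_insert_le _ _).trans (Nat.add_le_add_right ?_ 1)
    rw [← Set.ncard_eq_toFinset_card _ (hD (lbl K)).1]
    exact (hD _).2
  refine (Finset.card_le_card hsub).trans ((Finset.card_biUnion_le_card_mul _ _ _ hstar).trans ?_)
  have := w.support.toFinset_card_le
  rw [w.length_support, hw'] at this
  exact Nat.mul_le_mul_right _ this

variable (I) in
/-- The hyperplane `H` is the image of the first hyperplane of the window under an element
moving both ends of the corridor by at most `e`. -/
def IsMarker (e : ℕ) (H : Hyperplane (gpCayley Γ Gv)) : Prop := ∃ g, C.Moves e g ∧ tr g I.U = H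

variable {e : ℕ} {H K : Hyperplane (gpCayley Γ Gv)}

theorem deep_U : C.Deep (3 * C.δ + 9) I.U := deep_E ⟨le_rfl, I.lt⟩

theorem M_U : C.M I.U := M_E ⟨le_rfl, I.lt⟩

theorem IsMarker.M (h : I.IsMarker e H) (he : e ≤ C.δ) : C.M H := by
  obtain ⟨g, hg, rfl⟩ := h
  exact M_tr (hg.near he) (deep_U.mono (by omega)) M_U

theorem IsMarker.deep (h : I.IsMarker e H) (he : e ≤ C.δ) : C.Deep (2 * C.δ + 9) H := by
  obtain ⟨g, hg, rfl⟩ := h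
  exact Deep.tr (hg.near he) (deep_U.mono (by omega))

theorem IsMarker.lbl_eq (h : I.IsMarker e H) : lbl H = lbl I.U := by
  obtain ⟨g, hg, rfl⟩ := h
  exact lbl_tr _ _

theorem IsMarker.prec (h : I.IsMarker e H) (h' : I.IsMarker e K) (he : e ≤ C.δ)
    (hlt : C.pos H < C.pos K) : C.Prec H K :=
  prec_of_pos_lt (h.M he) (h'.M he) (by rw [h.lbl_eq, h'.lbl_eq]; exact Γ.loopless.irrefl _) hlt

theorem IsMarker.exists_tr_eq (h : I.IsMarker e H) (h' : I.IsMarker e K) (hδ : C.δ = 2 * e) :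
    ∃ f, C.Near f ∧ tr f H = K := by
  obtain ⟨g, hg, rfl⟩ := h
  obtain ⟨g', hg', rfl⟩ := h'
  refine ⟨g⁻¹ * g', (hg.inv.mul hg').near (by omega), ?_⟩
  rw [tr_tr, mul_inv_cancel_left]

theorem eq_of_tr_U_eq {g h : GraphProduct Γ Gv} (hδ : C.δ = 2 * e) (hg : C.Moves e g)
    (hh : C.Moves e h) (heq : tr g I.U = tr h I.U) : g = h := by
  refine mul_inv_eq_one.1 (I.eq_one_of_tr_U_eq ((hg.mul hh.inv).near (by omega)) ?_)
  rw [← tr_tr, heq, tr_tr, mul_inv_cancel, tr_one]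

theorem exists_of_chain (hδ : C.δ = 2 * e) {X : ℕ → Hyperplane (gpCayley Γ Gv)} {N : ℕ}
    (hN : I.W.card ≤ N) (hX : ∀ i ≤ N, I.IsMarker e (X i))
    (hlt : ∀ i j, i < j → j ≤ N → C.pos (X i) < C.pos (X j)) {w : ι} (hw : w ∈ I.W) :
    ∃ Y, C.M Y ∧ lbl Y = w ∧ C.Prec (X 0) Y ∧ (Y = X N ∨ C.Prec Y (X N)) := by
  classical
  have he : e ≤ C.δ := by omega
  have hprec : ∀ i j, i < j → j ≤ N → C.Prec (X i) (X j) := fun i j hij hj =>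
    (hX i (by omega)).prec (hX j hj) he (hlt i j hij hj)
  have hW : 1 ≤ I.W.card := Finset.card_pos.2 ⟨_, lbl_U_mem⟩
  have key : ∀ j, 1 ≤ j → j ≤ N → ∃ S ⊆ I.W, (∀ w ∈ S, ∃ Y, C.M Y ∧ lbl Y = w ∧
      C.Prec (X 0) Y ∧ (Y = X j ∨ C.Prec Y (X j))) ∧ (j ≤ S.card ∨ S = I.W) := by
    intro j hj
    induction j, hj using Nat.le_induction with
    | base =>
      refine fun h1 => ⟨{lbl I.U}, by simpa using lbl_U_mem, fun w hw => ?_, by simp⟩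
      rw [Finset.mem_singleton] at hw
      exact ⟨X 1, (hX 1 h1).M he, hw ▸ (hX 1 h1).lbl_eq, hprec 0 1 one_pos h1, Or.inl rfl⟩
    | succ j hj ih =>
      intro hj'
      obtain ⟨S, hSW, hS, hcard⟩ := ih (by omega)
      have hmono : ∀ w ∈ S, ∃ Y, C.M Y ∧ lbl Y = w ∧
          C.Prec (X 0) Y ∧ (Y = X (j + 1) ∨ C.Prec Y (X (j + 1))) := fun w hw => by
        obtain ⟨Y, h1, h2, h3, h4⟩ := hS w hw
        refine ⟨Y, h1, h2, h3, Or.inr ?_⟩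
        have hj₁ := hprec j (j + 1) (by omega) hj'
        rcases h4 with rfl | h4
        · exact hj₁
        · exact h4.trans hj₁
      by_cases hSe : S = I.W
      · exact ⟨S, hSW, hmono, Or.inr hSe⟩
      have hcard' := hcard.resolve_right hSe
      obtain ⟨s₀, hs₀⟩ := Finset.card_pos.1 (show 0 < S.card by omega)
      obtain ⟨t₀, ht₀, ht₀'⟩ := Finset.exists_of_ssubset (hSW.ssubset_of_ne hSe)
      obtain ⟨s, hs, hsS, t, ht, htS, hst⟩ := I.exists_not_adj (S := (S : Set ι))
        ⟨s₀, hSW hs₀, hs₀⟩ ⟨t₀, ht₀, ht₀'⟩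
      obtain ⟨Y, hY, rfl, h0Y, hYj⟩ := hS s hsS
      have hX0 := hX 0 (by omega)
      have hXj := hX j (by omega)
      obtain ⟨f, hf, hfX⟩ := hXj.exists_tr_eq (hX (j + 1) hj') hδ
      have dY : C.Deep (2 * C.δ + 7) Y := by
        refine Deep.between (hX0.M he) hY (hXj.M he) (hX0.deep he) (hXj.deep he)
          (h0Y.pos_lt (hX0.M he) hY).le ?_
        rcases hYj with rfl | h
        · rfl
        · exact (h.pos_lt hY (hXj.M he)).le
      have fwd : ∀ K, C.M K → C.Deep (2 * C.δ + 5) K → lbl K ∈ I.W → C.Prec K (tr f K) :=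
        fun K hK dK lK => I.prec_tr hf (hXj.M he) ((hXj.deep he).mono (by omega))
          (by rw [hXj.lbl_eq]; exact lbl_U_mem)
          (by rw [hfX]; exact hprec j (j + 1) (by omega) hj') hK dK lK
      obtain ⟨Y', hY', lY', h1, h2⟩ := I.exists_between hf fwd hY dY hs ht
        (fun h => htS (h ▸ hsS)) hst
      refine ⟨insert t S, Finset.insert_subset ht hSW, fun w hw => ?_, Or.inl ?_⟩
      · rcases Finset.mem_insert.1 hw with rfl | hw
        · refine ⟨Y', hY', lY', h0Y.trans h1, Or.inr ?_⟩
          rw [← hfX]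
          rcases hYj with rfl | h
          · exact h2
          · exact h2.trans (h.tr hf (dY.mono (by omega)))
        · exact hmono w hw
      · rw [Finset.card_insert_of_notMem (by simpa using htS)]
        omega
  obtain ⟨S, hSW, hS, hcard⟩ := key N (by omega) le_rfl
  have hSe : S = I.W := by
    rcases hcard with h | h
    · exact Finset.eq_of_subset_of_card_le hSW (by omega)
    · exact h
  exact hS w (hSe ▸ hw)

/-- Only boundedly many markers are in contact with a given hyperplane. -/
theorem card_le_of_contact (hδ : C.δ = 2 * e) {s : Finset ℕ}
    (hs : ∀ n ∈ s, n < C.P.n ∧ I.IsMarker e (C.P.E n) ∧ Contact (C.P.E n) K) :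
    s.card ≤ I.W.card + 2 := by
  by_contra! hcard
  have he : e ≤ C.δ := by omega
  obtain ⟨s', hs', hcard'⟩ := Finset.exists_subset_card_eq (show I.W.card + 3 ≤ s.card from hcard)
  let a : ℕ → ℕ := fun i => if h : i < I.W.card + 3 then s'.orderEmbOfFin hcard' ⟨i, h⟩ else 0
  have ha : ∀ i < I.W.card + 3, a i ∈ s := fun i hi => by
    simp only [a, dif_pos hi]
    exact hs' (Finset.orderEmbOfFin_mem _ _ _)
  have ha_lt : ∀ i j, i < j → j < I.W.card + 3 → a i < a j := fun i j hij hj => by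
    simp only [a, dif_pos hj, dif_pos (hij.trans hj)]
    exact (s'.orderEmbOfFin hcard').strictMono hij
  have hX : ∀ i < I.W.card + 3, I.IsMarker e (C.P.E (a i)) := fun i hi => (hs _ (ha i hi)).2.1
  have hpos : ∀ i < I.W.card + 3, C.pos (C.P.E (a i)) = a i := fun i hi =>
    pos_E (hs _ (ha i hi)).1
  have hlt : ∀ i j, i < j → j < I.W.card + 3 → C.pos (C.P.E (a i)) < C.pos (C.P.E (a j)) :=
    fun i j hij hj => by rw [hpos i (hij.trans hj), hpos j hj]; exact ha_lt i j hij hj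
  have hprec : ∀ i j, i < j → j < I.W.card + 3 → C.Prec (C.P.E (a i)) (C.P.E (a j)) :=
    fun i j hij hj => (hX i (hij.trans hj)).prec (hX j hj) he (hlt i j hij hj)
  obtain ⟨w, hw, hwK⟩ := I.exists_not_mem_star (lbl K)
  obtain ⟨Y, hY, rfl, h1, h2⟩ := I.exists_of_chain hδ (X := fun i => C.P.E (a (i + 1))) le_rfl
    (fun i hi => hX _ (by omega)) (fun i j hij hj => hlt _ _ (by omega) (by omega)) hw
  have h3 : C.Prec Y (C.P.E (a (I.W.card + 2))) := by
    have := hprec (I.W.card + 1) (I.W.card + 2) (by omega) (by omega)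
    rcases h2 with rfl | h2
    · exact this
    · exact h2.trans this
  obtain ⟨p, hp, hpK⟩ := (hs _ (ha 0 (by omega))).2.2
  obtain ⟨p', hp', hpK'⟩ := (hs _ (ha (I.W.card + 2) (by omega))).2.2
  refine hwK (contact_of_sep (H := Y) hpK hpK' ?_).2
  refine ((h3 p' hp').or p).resolve_left fun h => ?_
  have h01 := hlt 0 1 one_pos (by omega)
  have hM0 := (hX 0 (by omega)).M he
  have hM1 := (hX 1 (by omega)).M he
  have h4 : ¬ Sep (C.P.E (a 1)) p (C.P.q (C.pos (C.P.E (a 0)))) := by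
    refine not_sep_of_mem_nbh (fun h => ?_) ?_ hp (q_pos_mem hM0)
    · rw [h] at h01
      exact h01.false
    · rw [(hX 0 (by omega)).lbl_eq, (hX 1 (by omega)).lbl_eq]
      exact Γ.loopless.irrefl _
  have h5 := (sep_congr_right h4 _).1 (h1.sep h)
  exact h01.asymm ((sep_q_iff hM1 (pos_spec hM0).1.le).1 h5)

theorem card_markers_le (hδ : C.δ = 2 * e) {s : Finset ℕ}
    (hs : ∀ n ∈ s, n < C.P.n ∧ I.IsMarker e (C.P.E n)) :
    s.card ≤ (3 * C.δ + e + 14) * (I.W.card + 2) + 1 := by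
  classical
  have he : e ≤ C.δ := by omega
  rcases s.eq_empty_or_nonempty with rfl | hne
  · simp
  obtain ⟨m, hm⟩ : ∃ m, m = s.max' hne := ⟨_, rfl⟩
  have hms : m ∈ s := hm ▸ s.max'_mem hne
  have hmM := (hs m hms).2
  have hdist : cdist C.A (C.P.E m) ≤ 3 * C.δ + e + 13 := by
    obtain ⟨g, hg, h⟩ := hmM
    have h1 := cdist_triangle C.A (tr g C.A) (tr g I.U)
    rw [cdist_tr, h] at h1
    have h2 := hg.1
    have h3 : cdist C.A I.U = 3 * C.δ + 13 := I.cdist_A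
    omega
  obtain ⟨w, hw⟩ := (contactGraph_preconnected C.A (C.P.E m)).exists_walk_length_eq_dist
  have hsupp : w.support.toFinset.card ≤ 3 * C.δ + e + 14 := by
    have := w.support.toFinset_card_le
    rw [w.length_support, hw] at this
    exact this.trans (Nat.add_le_add_right hdist 1)
  have hex : ∀ n ∈ s.erase m, ∃ K ∈ w.support.toFinset, Contact (C.P.E n) K := by
    intro n hn
    rw [Finset.mem_erase] at hn
    obtain ⟨hnn, hnM⟩ := hs n hn.2
    have hlt : n < m := lt_of_le_of_ne (hm ▸ s.le_max' n hn.2) hn.1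
    have hprec := hnM.prec hmM he (by rwa [pos_E hnn, pos_E (hs m hms).1])
    have hrep := rep_mem_nbh (C.P.E m)
    obtain ⟨K, hK, hc, -⟩ := exists_contact_of_walk w C.ho hrep (hprec _ hrep)
    exact ⟨K, List.mem_toFinset.2 hK, hc⟩
  have hcard : (s.erase m).card ≤ w.support.toFinset.card * (I.W.card + 2) := by
    have hsub : s.erase m ⊆ w.support.toFinset.biUnion fun K =>
        (s.erase m).filter fun n => Contact (C.P.E n) K := fun n hn => by
      obtain ⟨K, hK, hc⟩ := hex n hn
      exact Finset.mem_biUnion.2 ⟨K, hK, Finset.mem_filter.2 ⟨hn, hc⟩⟩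
    refine (Finset.card_le_card hsub).trans (Finset.card_biUnion_le_card_mul _ _ _ fun K _ => ?_)
    refine I.card_le_of_contact (K := K) hδ fun n hn => ?_
    rw [Finset.mem_filter, Finset.mem_erase] at hn
    exact ⟨(hs n hn.1.2).1, (hs n hn.1.2).2, hn.2⟩
  rw [Finset.card_erase_of_mem hms] at hcard
  have := Nat.mul_le_mul_right (I.W.card + 2) hsupp
  omega

variable (I) in
theorem card_moves_le (hδ : C.δ = 2 * e) {T : Finset (GraphProduct Γ Gv)}
    (hT : ∀ g ∈ T, C.Moves e g) : T.card ≤ (3 * C.δ + e + 14) * (I.W.card + 2) + 1 := by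
  classical
  have he : e ≤ C.δ := by omega
  have hM : ∀ g ∈ T, C.M (tr g I.U) := fun g hg => IsMarker.M ⟨g, hT g hg, rfl⟩ he
  rw [← Finset.card_image_of_injOn (s := T) (f := fun g => C.pos (tr g I.U)) fun g hg h hh heq =>
    eq_of_tr_U_eq hδ (hT g hg) (hT h hh) (eq_of_pos_eq (hM g hg) (hM h hh) heq)]
  refine I.card_markers_le hδ fun n hn => ?_
  obtain ⟨g, hg, rfl⟩ := Finset.mem_image.1 hn
  obtain ⟨h1, h2⟩ := pos_spec (hM g hg)
  exact ⟨h1, g, hT g hg, h2.symm⟩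

end Window

end Corridor

/-- The action on the contact graph is acylindrical when the degrees of `Γ` are bounded. -/
theorem finite_and_ncard_le {D : ℕ}
    (hD : ∀ v, (Γ.neighborSet v).Finite ∧ (Γ.neighborSet v).ncard ≤ D) (e : ℕ)
    {A B : Hyperplane (gpCayley Γ Gv)} (hAB : 12 * e + 40 ≤ cdist A B) :
    {g : GraphProduct Γ Gv | cdist A (tr g A) ≤ e ∧ cdist B (tr g B) ≤ e}.Finite ∧
    {g : GraphProduct Γ Gv | cdist A (tr g A) ≤ e ∧ cdist B (tr g B) ≤ e}.ncard ≤
      (7 * e + 14) * (5 * (D + 1) + 2) + 1 := by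
  obtain ⟨P⟩ := exists_geodPath A (rep A) (rep B)
  let C : Corridor Γ Gv := ⟨A, B, rep A, rep B, rep_mem_nbh A, rep_mem_nbh B, P, 2 * e⟩
  obtain ⟨I⟩ := C.exists_window (show 6 * (2 * e) + 40 ≤ cdist A B by omega)
  have hcard : ∀ T : Finset (GraphProduct Γ Gv), (∀ g ∈ T, C.Moves e g) →
      T.card ≤ (7 * e + 14) * (5 * (D + 1) + 2) + 1 := fun T hT => by
    refine (I.card_moves_le rfl hT).trans (Nat.add_le_add_right (Nat.mul_le_mul ?_ ?_) 1)
    · exact (show 3 * (2 * e) + e + 14 ≤ _ by omega)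
    · exact Nat.add_le_add_right (Corridor.Window.card_W_le hD) 2
  have hfin : {g : GraphProduct Γ Gv | C.Moves e g}.Finite := by
    by_contra hinf
    obtain ⟨T, hT, hT'⟩ := Set.Infinite.exists_subset_card_eq hinf
      ((7 * e + 14) * (5 * (D + 1) + 2) + 2)
    have := hcard T fun g hg => hT hg
    omega
  refine ⟨hfin, ?_⟩
  refine (Set.ncard_eq_toFinset_card _ hfin).trans_le (hcard _ fun g hg => ?_)
  exact (Set.Finite.mem_toFinset hfin).1 hg

end Counting

/-- **Corollary C (first part).** For a graph product `Γ𝒢` of non-trivial groups with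
quasi-median Cayley graph `X`, the contact graph `𝒞X` is a quasi-tree; and if `Γ` has
bounded degree, then the induced (right multiplication) action of `Γ𝒢` on `𝒞X` is
acylindrical. -/
theorem gp_contactGraph_quasiTree_acylindrical {ι : Type*} (Γ : SimpleGraph ι)
    (Gv : ι → Type*) [∀ v, Group (Gv v)] (hnt : ∀ v, Nontrivial (Gv v)) :
    IsQuasiTreeGraph (contactGraph (gpCayley Γ Gv)) ∧
    (∀ D : ℕ, (∀ v : ι, (Γ.neighborSet v).Finite ∧ (Γ.neighborSet v).ncard ≤ D) →
      ∀ ε : ℝ, 0 < ε → ∃ Dc Nc : ℝ, 0 < Dc ∧ 0 < Nc ∧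
        ∀ A B : Hyperplane (gpCayley Γ Gv),
          Dc ≤ ((contactGraph (gpCayley Γ Gv)).dist A B : ℝ) →
          {g : GraphProduct Γ Gv |
              gpTranslateDistLE Γ Gv g A ε ∧ gpTranslateDistLE Γ Gv g B ε}.Finite ∧
          ({g : GraphProduct Γ Gv |
              gpTranslateDistLE Γ Gv g A ε ∧ gpTranslateDistLE Γ Gv g B ε}.ncard : ℝ) ≤ Nc) := by
  have := hnt
  refine ⟨isQuasiTreeGraph_contactGraph, fun D hD ε hε =>
    ⟨(12 * ⌊ε⌋₊ + 40 : ℕ), ((7 * ⌊ε⌋₊ + 14) * (5 * (D + 1) + 2) + 1 : ℕ), by positivity,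
      by positivity, fun A B hAB => ?_⟩⟩
  have hset : {g : GraphProduct Γ Gv |
      gpTranslateDistLE Γ Gv g A ε ∧ gpTranslateDistLE Γ Gv g B ε} =
      {g | cdist A (tr g A) ≤ ⌊ε⌋₊ ∧ cdist B (tr g B) ≤ ⌊ε⌋₊} := by
    ext g
    simp only [Set.mem_ofPred_eq, gpTranslateDistLE_iff, Nat.le_floor_iff hε.le]
  rw [hset]
  obtain ⟨h1, h2⟩ := finite_and_ncard_le hD ⌊ε⌋₊ (Nat.cast_le.1 hAB)
  exact ⟨h1, Nat.cast_le.2 h2⟩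

end QM
end

section
/- In a quasi-median graph X, no two hyperplanes can interosculate; that is, there are no two hyperplanes H and H' such that H and H' both intersect (at some vertex) and osculate (at some vertex). -/
namespace QM

section

open SimpleGraph (dist_eq_one_iff_adj)

variable {V : Type*} {X : SimpleGraph V}

lemma IsQuasiMedian.dist_eq_zero (hX : IsQuasiMedian X) {a b : V} :
    X.dist a b = 0 ↔ a = b :=
  hX.connected.dist_eq_zero_iff

/-- The distances to the two endpoints of an edge differ by at most one. -/
lemma IsQuasiMedian.dist_le_of_adj (hX : IsQuasiMedian X) (u : V) {a b : V} (h : X.Adj a b) :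
    X.dist u a ≤ X.dist u b + 1 ∧ X.dist u b ≤ X.dist u a + 1 := by
  have h1 := dist_eq_one_iff_adj.2 h
  have h2 := hX.connected.dist_triangle (u := u) (v := a) (w := b)
  have h3 := hX.connected.dist_triangle (u := u) (v := b) (w := a)
  rw [X.dist_comm (u := b)] at h3
  omega

lemma IsQuasiMedian.two_le_dist (hX : IsQuasiMedian X) {a b : V} (hne : a ≠ b)
    (hab : ¬ X.Adj a b) : 2 ≤ X.dist a b := by
  have h0 := mt hX.dist_eq_zero.1 hne
  have h1 := mt dist_eq_one_iff_adj.1 hab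
  omega

lemma IsQuasiMedian.dist_eq_two (hX : IsQuasiMedian X) {a b c : V} (hne : a ≠ b)
    (hab : ¬ X.Adj a b) (hac : X.Adj a c) (hbc : X.Adj b c) : X.dist a b = 2 := by
  have h2 := hX.two_le_dist hne hab
  have h3 := hX.dist_le_of_adj a hbc
  have h4 := dist_eq_one_iff_adj.2 hac
  omega

/-- Two distinct common neighbours of adjacent vertices are adjacent. -/
lemma IsQuasiMedian.adj_of_common (hX : IsQuasiMedian X) {p q x y : V} (hpq : X.Adj p q)
    (hpx : X.Adj p x) (hqx : X.Adj q x) (hpy : X.Adj p y) (hqy : X.Adj q y) (hxy : x ≠ y) :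
    X.Adj x y := by
  by_contra hn
  have hn' : ¬ X.Adj y x := fun h => hn h.symm
  refine hX.noK112.false ⟨⟨![p, q, x, y], ?_⟩, ?_⟩
  · intro i j hij
    have := hpq.ne; have := hpx.ne; have := hqx.ne; have := hpy.ne; have := hqy.ne
    fin_cases i <;> fin_cases j <;> simp_all [eq_comm]
  · intro i j
    change X.Adj (![p, q, x, y] i) (![p, q, x, y] j) ↔ _
    fin_cases i <;> fin_cases j <;>
      simp_all [K112, SimpleGraph.fromRel_adj, X.adj_comm]

/-- Vertices at distance two have at most two common neighbours. -/
lemma IsQuasiMedian.no_three_common (hX : IsQuasiMedian X) {a d b c y : V} (had : a ≠ d)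
    (hnad : ¬ X.Adj a d) (hab : X.Adj a b) (hac : X.Adj a c) (hay : X.Adj a y)
    (hdb : X.Adj d b) (hdc : X.Adj d c) (hdy : X.Adj d y) (hbc : b ≠ c) : y = b ∨ y = c := by
  by_contra! hy
  have key : ∀ {s t : V}, X.Adj a s → X.Adj a t → X.Adj d s → X.Adj d t → s ≠ t →
      X.dist s t = 2 := fun has hat hds hdt hst =>
    hX.dist_eq_two hst
      (fun h => hnad (hX.adj_of_common h has.symm hat.symm hds.symm hdt.symm had))
      has.symm hat.symm
  have h1 := key hab hac hdb hdc hbc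
  have h2 := key hab hay hdb hdy hy.1.symm
  have h3 := key hac hay hdc hdy hy.2.symm
  have med : ∀ e : V, X.Adj e b → X.Adj e c → X.Adj e y →
      IsQuasiMedianTriple X b c y (e, e, e) := by
    intro e hb hc hy
    have e1 := dist_eq_one_iff_adj.2 hb
    have e2 := dist_eq_one_iff_adj.2 hc
    have e3 := dist_eq_one_iff_adj.2 hy
    have e1' := dist_eq_one_iff_adj.2 hb.symm
    have e2' := dist_eq_one_iff_adj.2 hc.symm
    refine ⟨0, ?_, fun _ _ _ _ _ => Nat.zero_le _⟩
    simp only [IsQMTriple, OnGeod, SimpleGraph.dist_self, and_true]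
    omega
  have := (hX.uniqueQuasiMedian b c y).unique (med a hab hac hay) (med d hdb hdc hdy)
  exact had (Prod.mk.inj this).1

lemma IsQuasiMedian.exists_triple (hX : IsQuasiMedian X) (x₁ x₂ x₃ : V) :
    ∃ y₁ y₂ y₃ k, IsQMTriple X x₁ x₂ x₃ y₁ y₂ y₃ k := by
  obtain ⟨⟨y₁, y₂, y₃⟩, ⟨k, hk, -⟩, -⟩ := hX.uniqueQuasiMedian x₁ x₂ x₃
  exact ⟨y₁, y₂, y₃, k, hk⟩

/-- The triangle condition. -/
lemma IsQuasiMedian.triangle_condition (hX : IsQuasiMedian X) {u v w : V} {k : ℕ}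
    (hvw : X.Adj v w) (hv : X.dist u v = k + 1) (hw : X.dist u w = k + 1) :
    ∃ x, X.Adj x v ∧ X.Adj x w ∧ X.dist u x = k := by
  obtain ⟨y₁, y₂, y₃, j, h⟩ := hX.exists_triple u v w
  simp only [IsQMTriple, OnGeod] at h
  obtain ⟨h1, h2, h3, h4, h5, h6⟩ := h
  have h7 := dist_eq_one_iff_adj.2 hvw
  have e1 : X.dist y₂ v = X.dist v y₂ := X.dist_comm
  have hj : j = 1 := by omega
  obtain rfl : v = y₂ := hX.dist_eq_zero.1 (by omega)
  obtain rfl : y₃ = w := hX.dist_eq_zero.1 (by omega)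
  exact ⟨y₁, dist_eq_one_iff_adj.1 (by omega), dist_eq_one_iff_adj.1 (by omega), by omega⟩

/-- If `d` is at distance two from `a` and one further than `a` from `u`, then some common
neighbour of `a` and `d` is as far from `u` as `a`. -/
lemma IsQuasiMedian.exists_common_level (hX : IsQuasiMedian X) {u a d : V} {k : ℕ}
    (had : X.dist a d = 2) (ha : X.dist u a = k) (hd : X.dist u d = k + 1) :
    ∃ y, X.Adj a y ∧ X.Adj d y ∧ X.dist u y = k := by
  obtain ⟨y₁, y₂, y₃, j, h⟩ := hX.exists_triple u a d
  simp only [IsQMTriple, OnGeod] at h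
  obtain ⟨h1, h2, h3, h4, h5, h6⟩ := h
  have e1 : X.dist y₂ a = X.dist a y₂ := X.dist_comm
  have hj : j = 1 := by omega
  obtain rfl : a = y₂ := hX.dist_eq_zero.1 (by omega)
  have h7 : X.Adj y₃ d := dist_eq_one_iff_adj.1 (by omega)
  have h8 := hX.dist_le_of_adj u h7
  have h9 := hX.connected.dist_triangle (u := u) (v := y₁) (w := y₃)
  exact ⟨y₃, dist_eq_one_iff_adj.1 (by omega), h7.symm, by omega⟩

lemma cubeGraph_adj_iff {x y : Fin 3 → Bool} : cubeGraph.Adj x y ↔ hammingDist x y = 1 := by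
  have key : hammingDist x y = 1 ↔ ∃! i, x i ≠ y i := by
    simp [hammingDist, Finset.card_eq_one, Finset.ext_iff, ExistsUnique, iff_def,
      forall_and, and_comm]
  rw [key, cubeGraph, SimpleGraph.fromRel_adj]
  simp only [ne_comm (a := y _), or_self, and_iff_right_iff_imp]
  rintro ⟨i, hi, -⟩ rfl
  exact hi rfl

lemma hammingDist_eq_two : ∀ x z y : Fin 3 → Bool, hammingDist x z = 1 → hammingDist z y = 1 →
    x ≠ y → hammingDist x y = 2 := by
  decide

lemma exists_hammingDist_eq_one : ∀ x y z : Fin 3 → Bool, hammingDist x y = 2 →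
    hammingDist x z = 2 → hammingDist y z = 2 →
    ∃ w, hammingDist w x = 1 ∧ hammingDist w y = 1 ∧ hammingDist w z = 1 := by
  decide

/-- In a graph isomorphic to the cube, the vertices of even index of a hexagon have a common
neighbour. -/
lemma exists_common_of_iso_cubeGraph {W : Type*} {Y : SimpleGraph W} (φ : Y ≃g cubeGraph)
    {a b c d e f : W} (hab : Y.Adj a b) (hbc : Y.Adj b c) (hcd : Y.Adj c d) (hde : Y.Adj d e)
    (hef : Y.Adj e f) (hfa : Y.Adj f a) (hac : a ≠ c) (hce : c ≠ e) (hea : e ≠ a) :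
    ∃ x, Y.Adj x a ∧ Y.Adj x c ∧ Y.Adj x e := by
  have two : ∀ {s t r : W}, Y.Adj s t → Y.Adj t r → s ≠ r →
      hammingDist (φ s) (φ r) = 2 := fun {s t r} hst htr hsr =>
    hammingDist_eq_two (φ s) (φ t) (φ r) (cubeGraph_adj_iff.1 (φ.map_adj_iff.2 hst))
      (cubeGraph_adj_iff.1 (φ.map_adj_iff.2 htr)) (φ.injective.ne hsr)
  obtain ⟨w, h1, h2, h3⟩ := exists_hammingDist_eq_one _ _ _ (two hab hbc hac)
    (two hfa.symm hef.symm hea.symm) (two hcd hde hce)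
  refine ⟨φ.symm w, ?_, ?_, ?_⟩ <;> rw [← φ.map_adj_iff, φ.apply_symm_apply] <;>
    exact cubeGraph_adj_iff.2 ‹_›

/-- A function that satisfies the local rules of the graph distance is the graph distance. -/
lemma dist_eq_of_local {W : Type*} {Y : SimpleGraph W} (D : W → W → ℕ)
    (h_zero : ∀ i j, D i j = 0 ↔ i = j) (h_le : ∀ i j k, Y.Adj i j → D i k ≤ D j k + 1)
    (h_next : ∀ i k, i ≠ k → ∃ j, Y.Adj i j ∧ D i k = D j k + 1) (i j : W) :
    Y.dist i j = D i j := by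
  have upper : ∀ n i j, D i j = n → ∃ p : Y.Walk i j, p.length = n := by
    intro n
    induction n with
    | zero =>
      intro i j h
      obtain rfl := (h_zero i j).1 h
      exact ⟨.nil, rfl⟩
    | succ n ih =>
      intro i k h
      obtain ⟨j, hj, hd⟩ := h_next i k (fun h' => by rw [(h_zero i k).2 h'] at h; omega)
      obtain ⟨p, hp⟩ := ih j k (by omega)
      exact ⟨.cons hj p, by simp [hp]⟩
  have lower : ∀ {i j} (p : Y.Walk i j), D i j ≤ p.length := by
    intro i j p
    induction p with
    | nil => exact ((h_zero _ _).2 rfl).le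
    | cons h p ih => exact (h_le _ _ _ h).trans (Nat.succ_le_succ ih)
  obtain ⟨p, hp⟩ := upper _ i j rfl
  obtain ⟨q, hq⟩ := p.reachable.exists_walk_length_eq_dist
  exact le_antisymm (hp ▸ SimpleGraph.dist_le p) (hq ▸ lower q)

lemma C6_adj_iff (i j : Fin 6) : C6.Adj i j ↔ j = i + 1 ∨ i = j + 1 := by
  simp only [C6, SimpleGraph.fromRel_adj]
  revert i j
  decide

lemma C6_dist (i j : Fin 6) : C6.dist i j = min (j - i).val (i - j).val := by
  refine dist_eq_of_local (fun i j : Fin 6 => min (j - i).val (i - j).val) (by decide) ?_ ?_ i j <;>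
    simp only [C6_adj_iff] <;> decide

/-- In an isometric hexagon, the vertices of even index have a common neighbour. -/
lemma IsQuasiMedian.exists_common_of_hexagon (hX : IsQuasiMedian X) {a b c d e f : V}
    (hab : X.Adj a b) (hbc : X.Adj b c) (hcd : X.Adj c d) (hde : X.Adj d e) (hef : X.Adj e f)
    (hfa : X.Adj f a) (had : X.dist a d = 3) (hbe : X.dist b e = 3) (hcf : X.dist c f = 3) :
    ∃ x, X.Adj x a ∧ X.Adj x c ∧ X.Adj x e := by
  have two : ∀ {r s t v : V}, X.Adj r s → X.Adj s t → X.Adj t v → X.dist r v = 3 →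
      X.dist r t = 2 := by
    intro r s t v hrs hst htv hrv
    have h1 := dist_eq_one_iff_adj.2 hrs
    have h2 := hX.dist_le_of_adj r hst
    have h3 := hX.dist_le_of_adj r htv
    omega
  have hac := two hab hbc hcd had
  have hbd := two hbc hcd hde hbe
  have hce := two hcd hde hef hcf
  have hdf := two hde hef hfa (by rwa [X.dist_comm])
  have hea := two hef hfa hab (by rwa [X.dist_comm])
  have hfb := two hfa hab hbc (by rwa [X.dist_comm])
  obtain ⟨φ⟩ := hX.hullOfC6IsCube ![a, b, c, d, e, f]
    (by
      intro i j hij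
      rw [C6_adj_iff] at hij
      rcases hij with rfl | rfl
      · fin_cases i <;> assumption
      · fin_cases j <;> exact SimpleGraph.Adj.symm ‹_›)
    (by
      have h1 := dist_eq_one_iff_adj.2 hab
      have h2 := dist_eq_one_iff_adj.2 hbc
      have h3 := dist_eq_one_iff_adj.2 hcd
      have h4 := dist_eq_one_iff_adj.2 hde
      have h5 := dist_eq_one_iff_adj.2 hef
      have h6 := dist_eq_one_iff_adj.2 hfa
      intro i j
      rw [C6_dist]
      fin_cases i <;> fin_cases j <;>
        first
          | exact SimpleGraph.dist_self
          | assumption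
          | (refine SimpleGraph.dist_comm.trans ?_; assumption))
  have mem : ∀ i, ![a, b, c, d, e, f] i ∈
      convexHullSet X (Set.range ![a, b, c, d, e, f]) :=
    fun i T hT => hT.1 ⟨i, rfl⟩
  have ne_of_two : ∀ {s t : V}, X.dist s t = 2 → s ≠ t := by
    rintro s _ h rfl
    simp at h
  obtain ⟨x, h1, h2, h3⟩ := exists_common_of_iso_cubeGraph φ
    (a := ⟨a, mem 0⟩) (b := ⟨b, mem 1⟩) (c := ⟨c, mem 2⟩) (d := ⟨d, mem 3⟩) (e := ⟨e, mem 4⟩)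
    (f := ⟨f, mem 5⟩) hab hbc hcd hde hef hfa
    (fun h => ne_of_two hac (congrArg Subtype.val h))
    (fun h => ne_of_two hce (congrArg Subtype.val h))
    (fun h => ne_of_two hea (congrArg Subtype.val h))
  exact ⟨x, h1, h2, h3⟩

/-- The quadrangle condition. -/
lemma IsQuasiMedian.quadrangle_condition (hX : IsQuasiMedian X) {u : V} (k : ℕ) :
    ∀ {v w z : V}, X.Adj z v → X.Adj z w → v ≠ w → ¬ X.Adj v w →
      X.dist u v = k + 1 → X.dist u w = k + 1 → X.dist u z = k + 2 →
      ∃ x, X.Adj x v ∧ X.Adj x w ∧ X.dist u x = k := by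
  induction k with
  | zero =>
    intro v w z _ _ _ _ hv hw _
    exact ⟨u, dist_eq_one_iff_adj.1 hv, dist_eq_one_iff_adj.1 hw, X.dist_self⟩
  | succ k ih =>
    -- a chord of length two of the hexagon below already yields the conclusion
    have aux : ∀ {v w z m : V}, X.Adj z v → X.Adj z w → v ≠ w → ¬ X.Adj v w →
        X.dist u v = k + 2 → X.dist u w = k + 2 → X.dist u z = k + 3 →
        X.Adj m v → X.dist u m = k + 1 → X.dist m w ≤ 2 →
        ∃ x, X.Adj x v ∧ X.Adj x w ∧ X.dist u x = k + 1 := by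
      intro v w z m hzv hzw hne hnvw hv hw hz hmv hm hmw
      by_cases hmw1 : X.Adj m w
      · exact ⟨m, hmv, hmw1, hm⟩
      have hmw' : m ≠ w := by rintro rfl; omega
      have hmw2 := hX.two_le_dist hmw' hmw1
      have hvw2 := hX.dist_eq_two hne hnvw hzv.symm hzw.symm
      have c1 : X.dist m w = X.dist w m := X.dist_comm
      have c2 : X.dist v w = X.dist w v := X.dist_comm
      obtain ⟨x, hxm, hxv, hxw⟩ := hX.triangle_condition (u := w) (k := 1) hmv
        (by omega) (by omega)
      have hxw : X.Adj x w := (dist_eq_one_iff_adj.1 hxw).symm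
      have l1 := hX.dist_le_of_adj u hxm
      have l2 := hX.dist_le_of_adj u hxv
      by_cases hx : X.dist u x = k + 1
      · exact ⟨x, hxv, hxw, hx⟩
      have hx : X.dist u x = k + 2 := by omega
      obtain ⟨y, hyx, hyw, hy⟩ := hX.triangle_condition hxw hx hw
      by_cases hyv : X.Adj y v
      · exact ⟨y, hyv, hyw, hy⟩
      have hmy : m ≠ y := by rintro rfl; exact hyv hmv
      have hnmy : ¬ X.Adj m y := fun h => hyv
        (hX.adj_of_common hxm hyx.symm h hxv hmv (by rintro rfl; omega))
      obtain ⟨t, htm, hty, ht⟩ := ih hxm hyx.symm hmy hnmy hm hy hx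
      exfalso
      have hzx : ¬ X.Adj z x := fun h =>
        hnvw (hX.adj_of_common h hzv hxv hzw hxw hne)
      have dzx := hX.dist_eq_two (by rintro rfl; omega) hzx hzv hxv
      have l3 := hX.dist_le_of_adj x htm
      have l4 := dist_eq_one_iff_adj.2 hxm
      have dxt : X.dist x t = 2 := by
        have := hX.two_le_dist (a := x) (b := t) (by rintro rfl; omega)
          (fun h => by have := hX.dist_le_of_adj u h; omega)
        omega
      have dzt : X.dist z t = 3 := by
        have h1 := hX.connected.dist_triangle (u := u) (v := t) (w := z)
        have h2 := hX.dist_le_of_adj z htm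
        have h3 := hX.dist_le_of_adj z hmv
        have h4 := dist_eq_one_iff_adj.2 hzv
        rw [X.dist_comm (u := t)] at h1
        omega
      have med : ∀ {r s : V}, X.Adj z r → X.Adj r x → X.Adj r s → X.Adj x s → X.Adj s t →
          IsQuasiMedianTriple X z x t (r, x, s) := by
        intro r s h1 h2 h3 h4 h5
        have e1 := dist_eq_one_iff_adj.2 h1
        have e2 := dist_eq_one_iff_adj.2 h2
        have e3 := dist_eq_one_iff_adj.2 h3
        have e4 := dist_eq_one_iff_adj.2 h4
        have e5 := dist_eq_one_iff_adj.2 h5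
        refine ⟨1, ?_, ?_⟩
        · simp only [IsQMTriple, OnGeod, SimpleGraph.dist_self]
          omega
        · intro k' z₁ z₂ z₃ h
          simp only [IsQMTriple, OnGeod] at h
          have c3 : X.dist z₂ x = X.dist x z₂ := X.dist_comm
          omega
      have := (hX.uniqueQuasiMedian z x t).unique
        (med hzv hxv.symm hmv.symm hxm htm.symm) (med hzw hxw.symm hyw.symm hyx.symm hty.symm)
      exact hne (Prod.mk.inj this).1
    intro v w z hzv hzw hne hnvw hv hw hz
    have hvw2 := hX.dist_eq_two hne hnvw hzv.symm hzw.symm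
    obtain ⟨y₁, y₂, y₃, j, h⟩ := hX.exists_triple u v w
    simp only [IsQMTriple, OnGeod] at h
    obtain ⟨h1, h2, h3, h4, h5, h6⟩ := h
    have e1 : X.dist y₂ v = X.dist v y₂ := X.dist_comm
    have hj : j = 0 ∨ j = 2 := by omega
    rcases hj with rfl | rfl
    · obtain rfl := hX.dist_eq_zero.1 h4
      obtain rfl := hX.dist_eq_zero.1 h5
      exact ⟨y₁, dist_eq_one_iff_adj.1 (by omega), dist_eq_one_iff_adj.1 (by omega), by omega⟩
    · obtain rfl : v = y₂ := hX.dist_eq_zero.1 (by omega)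
      obtain rfl : y₃ = w := hX.dist_eq_zero.1 (by omega)
      have hy₁ : X.dist u y₁ = k := by omega
      have mid : ∀ {s t : V}, X.dist s t = 2 → ∃ m, X.Adj s m ∧ X.Adj m t := by
        intro s t hst
        obtain ⟨p, hp⟩ := hX.connected.exists_walk_length_eq_dist s t
        rw [hst] at hp
        match p, hp with
        | .cons h (.cons h' .nil), _ => exact ⟨_, h, h'⟩
      obtain ⟨m, hym, hmv⟩ := mid h4
      obtain ⟨n, hyn, hnw⟩ := mid h5
      have a1 := hX.dist_le_of_adj u hym
      have a2 := hX.dist_le_of_adj u hmv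
      have a3 := hX.dist_le_of_adj u hyn
      have a4 := hX.dist_le_of_adj u hnw
      by_cases hmw : X.dist m y₃ ≤ 2
      · exact aux hzv hzw hne hnvw hv hw hz hmv (by omega) hmw
      by_cases hnv : X.dist n v ≤ 2
      · obtain ⟨x, h1, h2, h3⟩ := aux hzw hzv hne.symm (fun h => hnvw h.symm) hw hv hz hnw
          (by omega) hnv
        exact ⟨x, h2, h1, h3⟩
      have b1 := hX.dist_le_of_adj y₁ hzv
      have b2 := hX.connected.dist_triangle (u := u) (v := y₁) (w := z)
      have b3 := hX.dist_le_of_adj m hzw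
      have b4 := hX.dist_le_of_adj m hzv
      have b5 := dist_eq_one_iff_adj.2 hmv
      have b6 := hX.dist_le_of_adj n hzw
      have b7 := hX.dist_le_of_adj n hzv
      have b8 := dist_eq_one_iff_adj.2 hnw
      obtain ⟨x, hxy, hxv, hxw⟩ := hX.exists_common_of_hexagon hym hmv hzv.symm hzw hnw.symm
        hyn.symm (by omega) (by omega) (by rw [X.dist_comm]; omega)
      have b9 := hX.dist_le_of_adj u hxy
      have b10 := hX.dist_le_of_adj u hxv
      exact ⟨x, hxv, hxw, by omega⟩

/-- The set of vertices closer to `a` than to `b`. -/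
def closerSet (X : SimpleGraph V) (a b : V) : Set V := {u | X.dist u a < X.dist u b}

/-- The sectors of the maximal clique containing the edge `e`. -/
def sectors (X : SimpleGraph V) (e : Sym2 V) : Set (Set V) :=
  {S | ∃ x y, X.Adj x y ∧ (∀ v ∈ e, x = v ∨ X.Adj x v) ∧ (∀ v ∈ e, y = v ∨ X.Adj y v) ∧
    S = closerSet X x y}

lemma IsQuasiMedian.closerSet_subset_of_triangle (hX : IsQuasiMedian X) {a b c : V}
    (hab : X.Adj a b) (hac : X.Adj a c) (hbc : X.Adj b c) :
    closerSet X a b ⊆ closerSet X a c := by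
  intro u (hu : X.dist u a < X.dist u b)
  change X.dist u a < X.dist u c
  have h1 := hX.dist_le_of_adj u hab
  have h2 := hX.dist_le_of_adj u hac
  have h3 := hX.dist_le_of_adj u hbc
  by_contra hc
  have hca : X.dist u c = X.dist u a := by omega
  rcases Nat.eq_zero_or_pos (X.dist u a) with h0 | h0
  · exact hac.ne ((hX.dist_eq_zero.1 h0).symm.trans (hX.dist_eq_zero.1 (hca.trans h0)))
  obtain ⟨x, hxa, hxc, hx⟩ := hX.triangle_condition (u := u) (k := X.dist u a - 1) hac
    (by omega) (by omega)
  have h4 := hX.dist_le_of_adj u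
    (hX.adj_of_common hac hxa.symm hxc.symm hab hbc.symm (by rintro rfl; omega))
  omega

lemma IsQuasiMedian.closerSet_eq_of_triangle (hX : IsQuasiMedian X) {a b c : V}
    (hab : X.Adj a b) (hac : X.Adj a c) (hbc : X.Adj b c) :
    closerSet X a b = closerSet X a c :=
  (hX.closerSet_subset_of_triangle hab hac hbc).antisymm
    (hX.closerSet_subset_of_triangle hac hab hbc.symm)

/-- `a b d c` is an induced square. -/
structure IsSquare (X : SimpleGraph V) (a b c d : V) : Prop where
  ab : X.Adj a b
  cd : X.Adj c d
  ac : X.Adj a c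
  bd : X.Adj b d
  ad_ne : a ≠ d
  bc_ne : b ≠ c
  ad : ¬ X.Adj a d
  bc : ¬ X.Adj b c

lemma IsSquare.flip {a b c d : V} (h : IsSquare X a b c d) : IsSquare X c d a b :=
  ⟨h.cd, h.ab, h.ac.symm, h.bd.symm, h.bc_ne.symm, h.ad_ne.symm, fun h' => h.bc h'.symm,
    fun h' => h.ad h'.symm⟩

lemma IsSquare.swap {a b c d : V} (h : IsSquare X a b c d) : IsSquare X b a d c :=
  ⟨h.ab.symm, h.cd.symm, h.bd, h.ac, h.bc_ne, h.ad_ne, h.bc, h.ad⟩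

lemma IsSquare.transpose {a b c d : V} (h : IsSquare X a b c d) : IsSquare X a c b d :=
  ⟨h.ac, h.bd, h.ab, h.cd, h.ad_ne, h.bc_ne.symm, h.ad, fun h' => h.bc h'.symm⟩

lemma IsQuasiMedian.closerSet_subset_of_square (hX : IsQuasiMedian X) {a b c d : V}
    (h : IsSquare X a b c d) : closerSet X a b ⊆ closerSet X c d := by
  intro u (hu : X.dist u a < X.dist u b)
  change X.dist u c < X.dist u d
  have h1 := hX.dist_le_of_adj u h.ab
  have h2 := hX.dist_le_of_adj u h.cd
  have h3 := hX.dist_le_of_adj u h.ac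
  have h4 := hX.dist_le_of_adj u h.bd
  have h5 := hX.dist_eq_two h.ad_ne h.ad h.ab h.bd.symm
  have h6 := fun y (hay : X.Adj a y) (hdy : X.Adj d y) =>
    hX.no_three_common h.ad_ne h.ad h.ab h.ac hay h.bd.symm h.cd.symm hdy h.bc_ne
  obtain hd | hd | hd : X.dist u d = X.dist u a + 2 ∨ X.dist u d = X.dist u a + 1 ∨
    X.dist u d = X.dist u a := by omega
  · omega
  · obtain ⟨y, hay, hdy, hy⟩ := hX.exists_common_level h5 rfl hd
    rcases h6 y hay hdy with rfl | rfl <;> omega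
  · rcases Nat.eq_zero_or_pos (X.dist u a) with h0 | h0
    · exact absurd ((hX.dist_eq_zero.1 h0).symm.trans (hX.dist_eq_zero.1 (hd.trans h0))) h.ad_ne
    obtain ⟨y, hya, hyd, hy⟩ := hX.quadrangle_condition (u := u) (X.dist u a - 1)
      h.ab.symm h.bd h.ad_ne h.ad (by omega) (by omega) (by omega)
    rcases h6 y hya.symm hyd.symm with rfl | rfl <;> omega

lemma IsQuasiMedian.closerSet_eq_of_square (hX : IsQuasiMedian X) {a b c d : V}
    (h : IsSquare X a b c d) : closerSet X a b = closerSet X c d :=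
  (hX.closerSet_subset_of_square h).antisymm (hX.closerSet_subset_of_square h.flip)

/-- A square sharing an edge with a triangle extends to a prism. -/
lemma IsQuasiMedian.exists_prism (hX : IsQuasiMedian X) {a b c d x : V}
    (h : IsSquare X a b c d) (hxa : X.Adj x a) (hxb : X.Adj x b) :
    ∃ y, X.Adj y d ∧ IsSquare X a x c y := by
  have hxc_ne : x ≠ c := by rintro rfl; exact h.bc hxb.symm
  have hxd_ne : x ≠ d := by rintro rfl; exact h.ad hxa.symm
  have hxc : ¬ X.Adj x c := fun hxc =>
    h.bc (hX.adj_of_common hxa hxb h.ab hxc h.ac h.bc_ne)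
  have hxd : ¬ X.Adj x d := fun hxd =>
    h.ad (hX.adj_of_common hxb hxa h.ab.symm hxd h.bd h.ad_ne)
  obtain ⟨y, hyc, hyd, hy⟩ := hX.triangle_condition (u := x) (k := 1) h.cd
    (hX.dist_eq_two hxc_ne hxc hxa h.ac.symm) (hX.dist_eq_two hxd_ne hxd hxb h.bd.symm)
  have hxy := dist_eq_one_iff_adj.1 hy
  refine ⟨y, hyd, hxa.symm, hyc.symm, h.ac, hxy, ?_, hxc_ne, ?_, hxc⟩
  · rintro rfl; exact h.ad hyd
  · intro hay
    exact h.ad (hX.adj_of_common hyc hay.symm h.ac.symm hyd h.cd h.ad_ne)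

lemma IsQuasiMedian.sectors_subset_of_triangle (hX : IsQuasiMedian X) {a b c : V}
    (hab : X.Adj a b) (hac : X.Adj a c) (hbc : X.Adj b c) :
    sectors X s(a, b) ⊆ sectors X s(a, c) := by
  have key : ∀ x, (∀ v ∈ s(a, b), x = v ∨ X.Adj x v) → ∀ v ∈ s(a, c), x = v ∨ X.Adj x v := by
    intro x hx
    simp only [Sym2.mem_iff, forall_eq_or_imp, forall_eq] at hx ⊢
    obtain ⟨rfl | hxa, rfl | hxb⟩ := hx
    · exact absurd rfl hab.ne
    · exact ⟨.inl rfl, .inr hac⟩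
    · exact ⟨.inr hxa, .inr hbc⟩
    · refine ⟨.inr hxa, or_iff_not_imp_left.2 fun hxc => ?_⟩
      exact hX.adj_of_common hab hxa.symm hxb.symm hac hbc hxc
  rintro S ⟨x, y, hxy, hx, hy, rfl⟩
  exact ⟨x, y, hxy, key x hx, key y hy, rfl⟩

lemma IsQuasiMedian.sectors_eq_of_triangle (hX : IsQuasiMedian X) {a b c : V}
    (hab : X.Adj a b) (hac : X.Adj a c) (hbc : X.Adj b c) :
    sectors X s(a, b) = sectors X s(a, c) :=
  (hX.sectors_subset_of_triangle hab hac hbc).antisymm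
    (hX.sectors_subset_of_triangle hac hab hbc.symm)

lemma closerSet_mem_sectors {a b : V} (hab : X.Adj a b) : closerSet X a b ∈ sectors X s(a, b) :=
  ⟨a, b, hab, by simp [hab], by simp [hab.symm], rfl⟩

/-- Every sector of an edge `ab` is the sector of `a`, or is the set of vertices closer
to `x` than to `a` for some `x` in the maximal clique containing `ab`. -/
lemma IsQuasiMedian.eq_of_mem_sectors (hX : IsQuasiMedian X) {a b : V} {S : Set V}
    (hab : X.Adj a b) (hS : S ∈ sectors X s(a, b)) :
    S = closerSet X a b ∨
      ∃ x, X.Adj x a ∧ (x = b ∨ X.Adj x b) ∧ S = closerSet X x a := by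
  obtain ⟨x, y, hxy, hx, hy, rfl⟩ := hS
  simp only [Sym2.mem_iff, forall_eq_or_imp, forall_eq] at hx hy
  obtain ⟨rfl | hxa, hxb⟩ := hx
  · left
    obtain ⟨-, rfl | hyb⟩ := hy
    · rfl
    · exact hX.closerSet_eq_of_triangle hxy hab hyb
  · refine .inr ⟨x, hxa, hxb, ?_⟩
    obtain ⟨rfl | hya, -⟩ := hy
    · rfl
    · exact hX.closerSet_eq_of_triangle hxy hxa hya

lemma IsQuasiMedian.sectors_subset_of_square (hX : IsQuasiMedian X) {a b c d : V}
    (h : IsSquare X a b c d) : sectors X s(a, b) ⊆ sectors X s(c, d) := by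
  intro S hS
  rcases hX.eq_of_mem_sectors h.ab hS with rfl | ⟨x, hxa, rfl | hxb, rfl⟩
  · rw [hX.closerSet_eq_of_square h]
    exact closerSet_mem_sectors h.cd
  · rw [hX.closerSet_eq_of_square h.swap, Sym2.eq_swap]
    exact closerSet_mem_sectors h.cd.symm
  · obtain ⟨y, hyd, hsq⟩ := hX.exists_prism h hxa hxb
    rw [hX.closerSet_eq_of_square hsq.swap]
    exact ⟨y, c, hsq.cd.symm, by simp [hsq.cd.symm, hyd], by simp [h.cd], rfl⟩

lemma IsQuasiMedian.sectors_eq_of_sideRel (hX : IsQuasiMedian X) {e f : Sym2 V}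
    (h : SideRel X e f) : sectors X e = sectors X f := by
  rcases h with ⟨a, b, c, hab, hac, hbc, rfl, rfl⟩ |
    ⟨a, b, c, d, hab, hcd, hac, hbd, had, hbc, rfl, rfl⟩
  · exact hX.sectors_eq_of_triangle hab hac hbc
  by_cases h1 : X.Adj a d
  · rw [hX.sectors_eq_of_triangle hab h1 hbd, Sym2.eq_swap (a := a), Sym2.eq_swap (a := c)]
    exact hX.sectors_eq_of_triangle h1.symm hcd.symm hac
  by_cases h2 : X.Adj b c
  · rw [Sym2.eq_swap (a := a), hX.sectors_eq_of_triangle hab.symm h2 hac,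
      Sym2.eq_swap (a := b)]
    exact hX.sectors_eq_of_triangle h2.symm hcd hbd
  have h : IsSquare X a b c d := ⟨hab, hcd, hac, hbd, had, hbc, h1, h2⟩
  exact (hX.sectors_subset_of_square h).antisymm (hX.sectors_subset_of_square h.flip)

lemma IsQuasiMedian.sectors_eq_of_mem (hX : IsQuasiMedian X) {H : Hyperplane X} {e f : Sym2 V}
    (he : e ∈ H.1) (hf : f ∈ H.1) : sectors X e = sectors X f := by
  have key : ∀ {e f : Sym2 V}, Relation.EqvGen (SideRel X) e f → sectors X e = sectors X f := by
    intro e f h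
    induction h with
    | rel _ _ h => exact hX.sectors_eq_of_sideRel h
    | refl _ => rfl
    | symm _ _ _ ih => exact ih.symm
    | trans _ _ _ _ _ ih₁ ih₂ => exact ih₁.trans ih₂
  obtain ⟨g, -, hg⟩ := H.2
  rw [hg] at he hf
  exact (key he).symm.trans (key hf)

/-- The sectors of two edges spanning a square meet pairwise. -/
lemma IsQuasiMedian.inter_nonempty_of_square (hX : IsQuasiMedian X) {p a b q : V}
    (h : IsSquare X p a b q) {S T : Set V} (hS : S ∈ sectors X s(p, a))
    (hT : T ∈ sectors X s(p, b)) : (S ∩ T).Nonempty := by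
  have far : ∀ {u v w : V}, X.Adj u v → u ≠ w → ¬ X.Adj u w → u ∈ closerSet X v w := by
    intro u v w huv huw hnuw
    have h1 := dist_eq_one_iff_adj.2 huv
    have h2 := hX.two_le_dist huw hnuw
    change X.dist u v < X.dist u w
    omega
  have near : ∀ {u v : V}, X.Adj u v → u ∈ closerSet X u v := by
    intro u v huv
    change X.dist u u < X.dist u v
    rw [SimpleGraph.dist_self, dist_eq_one_iff_adj.2 huv]
    exact one_pos
  have slide : ∀ {p a b q s : V}, IsSquare X p a b q → X.Adj s p → (s = a ∨ X.Adj s a) →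
      ∃ q', IsSquare X p s b q' := by
    rintro p a b q s h hsp (rfl | hsa)
    · exact ⟨q, h⟩
    · obtain ⟨q', -, h'⟩ := hX.exists_prism h hsp hsa
      exact ⟨q', h'⟩
  rcases hX.eq_of_mem_sectors h.ab hS with rfl | ⟨s, hsp, hsa, rfl⟩ <;>
    rcases hX.eq_of_mem_sectors h.ac hT with rfl | ⟨t, htp, htb, rfl⟩
  · exact ⟨p, near h.ab, near h.ac⟩
  · obtain ⟨q', h'⟩ := slide h.transpose htp htb
    exact ⟨t, far htp h'.bc_ne h'.bc, near htp⟩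
  · obtain ⟨q', h'⟩ := slide h hsp hsa
    exact ⟨s, near hsp, far hsp h'.bc_ne h'.bc⟩
  · obtain ⟨q', h'⟩ := slide h hsp hsa
    obtain ⟨r, h''⟩ := slide h'.transpose htp htb
    exact ⟨r, far h''.cd.symm h''.ad_ne.symm fun hh => h''.ad hh.symm,
      far h''.bd.symm h''.ad_ne.symm fun hh => h''.ad hh.symm⟩

end

/-- **Lemma (no interosculation).** In a quasi-median graph, no two hyperplanes both
intersect and osculate. -/
theorem no_interosculation {V : Type*} (X : SimpleGraph V) (hX : IsQuasiMedian X) :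
    ¬ ∃ H H' : Hyperplane X, H ≠ H' ∧ HypIntersect X H H' ∧ HypOsculate X H H' := by
  rintro ⟨H, H', -, ⟨p, _, he, _, he', a, b, rfl, rfl, hpa, hpb, hab, hnab, q, hqp, haq, hbq⟩,
    p', _, hf, _, hf', a', b', rfl, rfl, hpa', hpb', hab', hnab', hno⟩
  have hsq : IsSquare X p a b q := ⟨hpa, hbq, hpb, haq, hqp.symm, hab,
    fun hpq => hnab (hX.adj_of_common hpq hpa haq.symm hpb hbq.symm hab), hnab⟩
  have hS : closerSet X a' p' ∈ sectors X s(p, a) := by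
    rw [hX.sectors_eq_of_mem he hf, Sym2.eq_swap]
    exact closerSet_mem_sectors hpa'.symm
  have hT : closerSet X b' p' ∈ sectors X s(p, b) := by
    rw [hX.sectors_eq_of_mem he' hf', Sym2.eq_swap]
    exact closerSet_mem_sectors hpb'.symm
  obtain ⟨u, hua, hub⟩ := hX.inter_nonempty_of_square hsq hS hT
  change X.dist u a' < X.dist u p' at hua
  change X.dist u b' < X.dist u p' at hub
  have h1 := hX.dist_le_of_adj u hpa'
  have h2 := hX.dist_le_of_adj u hpb'
  rcases Nat.eq_zero_or_pos (X.dist u a') with h0 | h0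
  · exact hab' ((hX.dist_eq_zero.1 h0).symm.trans (hX.dist_eq_zero.1 (by omega)))
  obtain ⟨x, hxa, hxb, hx⟩ := hX.quadrangle_condition (u := u) (X.dist u a' - 1) hpa' hpb' hab'
    hnab' (by omega) (by omega) (by omega)
  exact hno ⟨x, by rintro rfl; omega, hxa.symm, hxb.symm⟩

end QM
end
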